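/- arXiv:2302.11390 — 7 statements merged into one kernel-verified Lean document; each statement's English description precedes it below -/
import Mathlib

section
/- Let ε > 0 and let Q be a finite poset of height h(Q) ≥ 2. For every finite poset P, if t(Q,P) < (ε/2)^{h(Q)·w(Q)²}, then there exists a subposet of P obtained by the removal of at most ε·|P|² edges that is C_{h(Q)}-free (and hence Q-free). -/
/-- A strict partial order relation: irreflexive and transitive. -/
def IsStrictOrd {α : Type*} (r : α → α → Prop) : Prop :=
  (∀ x, ¬ r x x) ∧ (∀ ⦃x y z⦄, r x y → r y z → r x z)

/-- An order-preserving map between relations. -/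
def IsPosetHom {β : Type*} {α : Type*} (q : β → β → Prop) (p : α → α → Prop)
    (f : β → α) : Prop :=
  ∀ ⦃x y⦄, q x y → p (f x) (f y)

/-- The homomorphism density `t(Q,P)`: the probability that a uniformly random map from the
ground set of `Q` to the ground set of `P` is order-preserving. -/
noncomputable def homDensity {β : Type*} {α : Type*} [Fintype β] [Fintype α]
    (q : β → β → Prop) (p : α → α → Prop) : ℝ :=
  (Nat.card {f : β → α // IsPosetHom q p f} : ℝ) / (Fintype.card α : ℝ) ^ (Fintype.card β)

/-- `HasChain p h` means the relation `p` contains a copy of the chain `C_h`,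
i.e. elements `x_1 ≺ x_2 ≺ ⋯ ≺ x_h`. -/
def HasChain {α : Type*} (p : α → α → Prop) (h : ℕ) : Prop :=
  ∃ f : Fin h → α, ∀ ⦃i j : Fin h⦄, i < j → p (f i) (f j)

/-- The height of a poset: the maximum number of elements of a chain. -/
noncomputable def posetHeight {α : Type*} [Fintype α] (p : α → α → Prop) : ℕ :=
  sSup {n | HasChain p n}

/-- The width of a poset: the maximum number of elements of an antichain. -/
noncomputable def posetWidth {α : Type*} [Fintype α] (p : α → α → Prop) : ℕ :=
  sSup {n | ∃ s : Finset α, s.card = n ∧ ∀ x ∈ s, ∀ y ∈ s, ¬ p x y}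

/-- `SubposetRel p' p` : the relation `p'` is contained in `p` (a subposet on the same ground set,
obtained by removing edges). -/
def SubposetRel {α : Type*} (p' p : α → α → Prop) : Prop :=
  ∀ ⦃x y⦄, p' x y → p x y

/-- The number of removed edges: pairs `(x,y)` with `x ≺ y` in `p` but not in `p'`. -/
noncomputable def removedEdges {α : Type*} [Fintype α] (p p' : α → α → Prop) : ℕ :=
  Nat.card {e : α × α // p e.1 e.2 ∧ ¬ p' e.1 e.2}

/-- The chain `C_h` with `h` elements. -/
def chainRel (h : ℕ) : Fin h → Fin h → Prop := fun i j => i < j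

/-- `P` contains `Q` as a (not necessarily induced) subposet:
there is an injective order-preserving map from `Q` to `P`. -/
def ContainsAsSubposet {β : Type*} {α : Type*} (q : β → β → Prop)
    (p : α → α → Prop) : Prop :=
  ∃ f : β → α, Function.Injective f ∧ IsPosetHom q p f

/-- A relation on a product is counted by summing the sizes of its fibres. -/
lemma card_subtype_prod_eq_sum {A B : Type*} [Fintype A] [Finite B] (F : A → B → Prop) :
    Nat.card {x : A × B // F x.1 x.2} = ∑ a, Nat.card {b // F a b} := by
  rw [← Nat.card_sigma]
  exact Nat.card_congr (Equiv.subtypeProdEquivSigmaSubtype F)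

/-- Replacing the second vertex of an edge by `n + 1` independent copies. -/
lemma card_edges_pow_le {A B : Type*} [Fintype A] [Finite B] (F : A → B → Prop) (n : ℕ) :
    Nat.card {x : A × B // F x.1 x.2} ^ (n + 1) ≤ Fintype.card A ^ n *
      Nat.card {x : A × (Fin (n + 1) → B) // ∀ j, F x.1 (x.2 j)} := by
  rw [card_subtype_prod_eq_sum F,
    card_subtype_prod_eq_sum (fun a (b : Fin (n + 1) → B) => ∀ j, F a (b j))]
  have hfib (a : A) : Nat.card {b : Fin (n + 1) → B // ∀ j, F a (b j)} =
      Nat.card {b // F a b} ^ (n + 1) := by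
    rw [Nat.card_congr (Equiv.subtypePiEquivPi (p := fun (_ : Fin (n + 1)) b => F a b)),
      Nat.card_pi]
    simp
  simp_rw [hfib]
  exact pow_sum_le_card_mul_sum_pow (fun _ _ => Nat.zero_le _) n

/-- The complete bipartite graph `K_{n+1,n+1}` is Sidorenko. -/
lemma card_edges_pow_mul_self_le {A B : Type*} [Fintype A] [Fintype B] (F : A → B → Prop)
    (n : ℕ) :
    Nat.card {x : A × B // F x.1 x.2} ^ ((n + 1) * (n + 1)) ≤
      (Fintype.card A * Fintype.card B) ^ (n * (n + 1)) *
      Nat.card {x : (Fin (n + 1) → B) × (Fin (n + 1) → A) // ∀ i j, F (x.2 i) (x.1 j)} := by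
  have hswap : Nat.card {x : A × (Fin (n + 1) → B) // ∀ j, F x.1 (x.2 j)} =
      Nat.card {x : (Fin (n + 1) → B) × A // ∀ j, F x.2 (x.1 j)} :=
    Nat.card_congr ((Equiv.prodComm _ _).subtypeEquiv fun _ => Iff.rfl)
  have h₁ := card_edges_pow_le F n
  have h₂ := card_edges_pow_le (fun (b : Fin (n + 1) → B) a => ∀ j, F a (b j)) n
  rw [hswap] at h₁
  calc _ = (Nat.card {x : A × B // F x.1 x.2} ^ (n + 1)) ^ (n + 1) := pow_mul _ _ _
    _ ≤ (Fintype.card A ^ n *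
        Nat.card {x : (Fin (n + 1) → B) × A // ∀ j, F x.2 (x.1 j)}) ^ (n + 1) := by gcongr
    _ = Fintype.card A ^ (n * (n + 1)) *
        Nat.card {x : (Fin (n + 1) → B) × A // ∀ j, F x.2 (x.1 j)} ^ (n + 1) := by
      rw [mul_pow, ← pow_mul]
    _ ≤ _ := by
      refine (Nat.mul_le_mul_left _ h₂).trans_eq ?_
      simp only [Fintype.card_pi, Finset.prod_const, Finset.card_univ, Fintype.card_fin]
      rw [mul_pow, ← pow_mul, mul_comm (n + 1) n, mul_assoc]

/-- The blow-up of the chain `C_h` in which each element is replaced by `w` incomparable ones. -/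
def chainBlowup (w h : ℕ) : Fin w × Fin h → Fin w × Fin h → Prop := fun x y => x.2 < y.2

/-- Two families of maps, on the even and on the odd levels, such that any choice of one from each
family merges to a chain, form a homomorphism from the blow-up of the chain. -/
lemma isPosetHom_chainBlowup {α : Type*} {p : α → α → Prop} (hp : IsStrictOrd p) {w h : ℕ}
    (a b : Fin w → Fin h → α)
    (hab : ∀ i j, IsPosetHom (chainRel h) p
      fun k => if Even (k : ℕ) then a i k else b j k) :
    IsPosetHom (chainBlowup w h) p
      fun x => if Even (x.2 : ℕ) then a x.1 x.2 else b x.1 x.2 := by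
  have key (i j : Fin w) (k l : Fin h) (hkl : k < l) (hpar : ¬(Even (k : ℕ) ↔ Even (l : ℕ))) :
      p (if Even (k : ℕ) then a i k else b i k) (if Even (l : ℕ) then a j l else b j l) := by
    by_cases hk : Even (k : ℕ)
    · have hl : ¬ Even (l : ℕ) := by tauto
      simpa [hk, hl] using hab i j hkl
    · have hl : Even (l : ℕ) := by tauto
      simpa [hk, hl] using hab j i hkl
  rintro ⟨i, k⟩ ⟨j, l⟩ (hkl : k < l)
  by_cases hpar : (Even (k : ℕ) ↔ Even (l : ℕ))
  · have hne : (k : ℕ) + 1 ≠ l := by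
      intro h
      rw [← h, Nat.even_add_one] at hpar
      tauto
    have hlt : (k : ℕ) < l := hkl
    let m : Fin h := ⟨k + 1, by omega⟩
    have hkm : ¬(Even (k : ℕ) ↔ Even (m : ℕ)) := by
      simp only [m, Nat.even_add_one]
      tauto
    refine hp.2 (key i i k m (Nat.lt_succ_self _) hkm) (key i j m l ?_ (by tauto))
    exact lt_of_le_of_ne hlt (by simpa [m, Fin.ext_iff] using hne)
  · exact key i j k l hkl hpar

/-- Counting homomorphisms from the blow-up of a chain in terms of chains. -/
lemma card_chains_pow_le {α : Type*} [Fintype α] {p : α → α → Prop} (hp : IsStrictOrd p)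
    (n h : ℕ) :
    Nat.card {f : Fin h → α // IsPosetHom (chainRel h) p f} ^ ((n + 1) * (n + 1)) ≤
      (Fintype.card α ^ h) ^ (n * (n + 1)) *
      Nat.card {g : Fin (n + 1) × Fin h → α // IsPosetHom (chainBlowup (n + 1) h) p g} := by
  let A := {k : Fin h // Even (k : ℕ)} → α
  let B := {k : Fin h // ¬ Even (k : ℕ)} → α
  let e : (Fin h → α) ≃ A × B := Equiv.piEquivPiSubtypeProd _ _
  let F : A → B → Prop := fun a b => IsPosetHom (chainRel h) p (e.symm (a, b))
  have hcard : Fintype.card A * Fintype.card B = Fintype.card α ^ h := by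
    rw [← Fintype.card_prod, ← Fintype.card_congr e]
    simp
  have hedge : Nat.card {f : Fin h → α // IsPosetHom (chainRel h) p f} =
      Nat.card {x : A × B // F x.1 x.2} :=
    Nat.card_congr (e.subtypeEquiv fun f => by simp [F])
  rw [hedge, ← hcard]
  refine (card_edges_pow_mul_self_le F n).trans (Nat.mul_le_mul_left _ ?_)
  have hsymm (a : A) (b : B) (k : Fin h) : e.symm (a, b) k =
      if hk : Even (k : ℕ) then a ⟨k, hk⟩ else b ⟨k, hk⟩ := rfl
  refine Nat.card_le_card_of_injective
    (fun x => ⟨fun y => e.symm (x.1.2 y.1, x.1.1 y.1) y.2, ?_⟩) ?_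
  · have := isPosetHom_chainBlowup hp
      (fun i k => e.symm (x.1.2 i, x.1.1 i) k) (fun i k => e.symm (x.1.2 i, x.1.1 i) k)
      (fun i j => by
        convert x.2 i j using 1
        funext k
        by_cases hk : Even (k : ℕ) <;> simp [hsymm, hk])
    simpa using this
  · rintro ⟨⟨b, a⟩, _⟩ ⟨⟨b', a'⟩, _⟩ heq
    have hval (i : Fin (n + 1)) : (a i, b i) = (a' i, b' i) :=
      e.symm.injective (funext fun k => congrFun (Subtype.ext_iff.1 heq) (i, k))
    simp only [Subtype.mk.injEq, Prod.mk.injEq]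
    exact ⟨funext fun i => (Prod.ext_iff.1 (hval i)).2, funext fun i => (Prod.ext_iff.1 (hval i)).1⟩

/-- Homomorphism densities do not decrease when passing to a subposet of the source. -/
lemma card_hom_mul_le {α β γ : Type*} [Fintype α] [Fintype β] [Fintype γ] {q : β → β → Prop}
    {r : γ → γ → Prop} (p : α → α → Prop) (ι : β ↪ γ) (hι : ∀ ⦃x y⦄, q x y → r (ι x) (ι y)) :
    Nat.card {g : γ → α // IsPosetHom r p g} * Fintype.card α ^ Fintype.card β ≤
      Nat.card {f : β → α // IsPosetHom q p f} * Fintype.card α ^ Fintype.card γ := by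
  classical
  have hle : Nat.card {g : γ → α // IsPosetHom r p g} ≤
      Nat.card ({f : β → α // IsPosetHom q p f} × ({y // y ∉ Set.range ι} → α)) := by
    refine Nat.card_le_card_of_injective
      (fun g => (⟨g.1 ∘ ι, fun x y hxy => g.2 (hι hxy)⟩, fun y => g.1 y)) ?_
    rintro ⟨g, hg⟩ ⟨g', hg'⟩ heq
    have h₁ := congrArg (fun t => t.1.1) heq
    have h₂ := congrArg Prod.snd heq
    refine Subtype.ext (funext fun y => ?_)
    by_cases hy : y ∈ Set.range ι
    · obtain ⟨x, rfl⟩ := hy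
      exact congrFun h₁ x
    · exact congrFun h₂ ⟨y, hy⟩
  have hcompl : Fintype.card {y // y ∉ Set.range ι} + Fintype.card β = Fintype.card γ := by
    have h₁ := Fintype.card_subtype_compl (fun y => y ∈ Set.range ι)
    have h₂ : Fintype.card {y // y ∈ Set.range ι} = Fintype.card β :=
      (Fintype.card_congr (Equiv.ofInjective ι ι.injective)).symm
    have h₃ := Fintype.card_le_of_injective ι ι.injective
    omega
  rw [Nat.card_prod, Nat.card_pi, Finset.prod_const, Finset.card_univ,
    Nat.card_eq_fintype_card (α := α)] at hle
  calc _ ≤ _ := Nat.mul_le_mul_right _ hle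
    _ = _ := by rw [mul_assoc, ← pow_add, hcompl]

/-- Chains have distinct elements. -/
lemma IsStrictOrd.card_le_of_chain {α : Type*} [Fintype α] {p : α → α → Prop}
    (hp : IsStrictOrd p) {n : ℕ} (hn : HasChain p n) : n ≤ Fintype.card α := by
  obtain ⟨f, hf⟩ := hn
  have hinj : Function.Injective f := by
    intro i j hij
    by_contra hne
    rcases lt_or_gt_of_ne hne with h | h
    · exact hp.1 (f j) (by simpa [hij] using hf h)
    · exact hp.1 (f j) (by simpa [hij] using hf h)
  simpa using Fintype.card_le_of_injective f hinj

lemma IsStrictOrd.bddAbove_chain {α : Type*} [Fintype α] {p : α → α → Prop}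
    (hp : IsStrictOrd p) : BddAbove {n | HasChain p n} :=
  ⟨Fintype.card α, fun _ hn => hp.card_le_of_chain hn⟩

lemma IsStrictOrd.le_posetHeight {α : Type*} [Fintype α] {p : α → α → Prop}
    (hp : IsStrictOrd p) {n : ℕ} (hn : HasChain p n) : n ≤ posetHeight p :=
  le_csSup hp.bddAbove_chain hn

lemma IsStrictOrd.hasChain_posetHeight {α : Type*} [Fintype α] {p : α → α → Prop}
    (hp : IsStrictOrd p) : HasChain p (posetHeight p) :=
  Nat.sSup_mem (s := {n | HasChain p n}) ⟨0, fun i => i.elim0, fun i => i.elim0⟩ hp.bddAbove_chain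

lemma card_le_posetWidth {α : Type*} [Fintype α] {p : α → α → Prop} {s : Finset α}
    (hs : ∀ x ∈ s, ∀ y ∈ s, ¬ p x y) : s.card ≤ posetWidth p :=
  le_csSup (s := {n | ∃ s : Finset α, s.card = n ∧ ∀ x ∈ s, ∀ y ∈ s, ¬ p x y})
    ⟨Fintype.card α, by rintro _ ⟨t, rfl, _⟩; exact t.card_le_univ⟩ ⟨s, rfl, hs⟩

/-- A finite poset admits a strictly monotone map to the chain of the same height. -/
lemma IsStrictOrd.exists_level {α : Type*} [Fintype α] {p : α → α → Prop}
    (hp : IsStrictOrd p) :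
    ∃ l : α → Fin (posetHeight p), ∀ ⦃x y⦄, p x y → l x < l y := by
  classical
  let S (x : α) (k : ℕ) : Prop :=
    ∃ f : Fin (k + 1) → α, IsPosetHom (chainRel (k + 1)) p f ∧ f (Fin.last k) = x
  have hS0 (x : α) : S x 0 :=
    ⟨fun _ => x, fun i j hij => absurd hij (by simp [chainRel, show i = j by omega]), rfl⟩
  have hlt {x : α} {k : ℕ} (h : S x k) : k < posetHeight p := by
    obtain ⟨f, hf, _⟩ := h
    exact hp.le_posetHeight ⟨f, hf⟩
  have hsucc {x y : α} {k : ℕ} (h : S x k) (hxy : p x y) : S y (k + 1) := by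
    obtain ⟨f, hf, hfx⟩ := h
    refine ⟨Fin.snoc f y, ?_, by simp⟩
    have hlast (i : Fin (k + 1)) : p (f i) y := by
      rcases (Fin.le_last i).eq_or_lt with rfl | hi
      · rwa [hfx]
      · exact hp.2 (hf hi) (by rwa [hfx])
    intro i j (hij : i < j)
    induction j using Fin.lastCases with
    | last =>
      induction i using Fin.lastCases with
      | last => exact absurd hij (lt_irrefl _)
      | cast i => simpa using hlast i
    | cast j =>
      induction i using Fin.lastCases with
      | last => exact absurd hij (Fin.le_last _).not_gt
      | cast i => simpa using hf (x := i) (y := j) (by simpa [chainRel] using hij)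
  let l (x : α) : ℕ := Nat.findGreatest (S x) (posetHeight p)
  have hl (x : α) : S x (l x) := Nat.findGreatest_spec (Nat.zero_le _) (hS0 x)
  refine ⟨fun x => ⟨l x, hlt (hl x)⟩, fun x y hxy => ?_⟩
  have h := hsucc (hl x) hxy
  exact Nat.le_findGreatest (hlt h).le h

/-- A finite poset embeds in the blow-up of a chain of its height by its width. -/
lemma IsStrictOrd.exists_embedding_chainBlowup {α : Type*} [Fintype α] {p : α → α → Prop}
    (hp : IsStrictOrd p) :
    ∃ ι : α ↪ Fin (posetWidth p) × Fin (posetHeight p),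
      ∀ ⦃x y⦄, p x y → chainBlowup (posetWidth p) (posetHeight p) (ι x) (ι y) := by
  classical
  obtain ⟨l, hl⟩ := hp.exists_level
  have hcard (k : Fin (posetHeight p)) : Fintype.card {x // l x = k} ≤ posetWidth p := by
    rw [Fintype.card_subtype]
    refine card_le_posetWidth fun x hx y hy hxy => (hl hxy).ne ?_
    simp only [Finset.mem_filter] at hx hy
    rw [hx.2, hy.2]
  have hemb (k : Fin (posetHeight p)) : Nonempty ({x // l x = k} ↪ Fin (posetWidth p)) :=
    Function.Embedding.nonempty_of_card_le (by simpa using hcard k)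
  let e (k : Fin (posetHeight p)) := (hemb k).some
  refine ⟨⟨fun x => (e (l x) ⟨x, rfl⟩, l x), fun x y hxy => ?_⟩, fun x y hxy => hl hxy⟩
  rw [Prod.mk.injEq] at hxy
  have hy : e (l x) ⟨y, hxy.2.symm⟩ = e (l y) ⟨y, rfl⟩ := by
    generalize_proofs h
    revert h
    generalize l x = k
    rintro rfl
    rfl
  exact congrArg Subtype.val ((e (l x)).injective (hxy.1.trans hy.symm))

open scoped Classical in
/-- The elements from which one can ascend `k` times, with at least `c` choices in each step. -/
noncomputable def robustSet {α : Type*} [Fintype α] (p : α → α → Prop) (c : ℝ) : ℕ → Finset α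
  | 0 => Finset.univ
  | k + 1 => {x | c ≤ Nat.card {y // y ∈ robustSet p c k ∧ p x y}}

lemma mem_robustSet_succ {α : Type*} [Fintype α] {p : α → α → Prop} {c : ℝ} {k : ℕ} {x : α} :
    x ∈ robustSet p c (k + 1) ↔ c ≤ Nat.card {y // y ∈ robustSet p c k ∧ p x y} := by
  simp [robustSet]

lemma robustSet_antitone {α : Type*} [Fintype α] (p : α → α → Prop) (c : ℝ) :
    Antitone (robustSet p c) := by
  refine antitone_nat_of_succ_le fun k => ?_
  induction k with
  | zero => simp [robustSet]
  | succ k ih =>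
    intro x hx
    rw [mem_robustSet_succ] at hx ⊢
    refine hx.trans ?_
    exact_mod_cast Nat.card_le_card_of_injective
      (fun y : {y // y ∈ robustSet p c (k + 1) ∧ p x y} =>
        (⟨y.1, ih y.2.1, y.2.2⟩ : {y // y ∈ robustSet p c k ∧ p x y}))
      fun y z h => Subtype.ext (congrArg (fun t => t.1) h)

/-- Prepending a smaller element to a chain. -/
lemma IsPosetHom.chain_cons {α : Type*} {p : α → α → Prop} (hp : IsStrictOrd p) {k : ℕ}
    {f : Fin (k + 1) → α} (hf : IsPosetHom (chainRel (k + 1)) p f) {x : α} (hx : p x (f 0)) :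
    IsPosetHom (chainRel (k + 2)) p (Fin.cons x f : Fin (k + 2) → α) := by
  have hfirst (j : Fin (k + 1)) : p x (f j) := by
    rcases (Fin.zero_le j).eq_or_lt with rfl | hj
    · exact hx
    · exact hp.2 hx (hf hj)
  intro i j (hij : i < j)
  induction j using Fin.cases with
  | zero => exact absurd hij (Fin.not_lt_zero i)
  | succ j =>
    induction i using Fin.cases with
    | zero => simpa using hfirst j
    | succ i => simpa using hf (x := i) (y := j) (by simpa [chainRel] using hij)

/-- Elements of `robustSet p c k` are the minimum of at least `c ^ k` chains. -/
lemma pow_le_card_chains_from {α : Type*} [Fintype α] {p : α → α → Prop} (hp : IsStrictOrd p)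
    {c : ℝ} (hc : 0 ≤ c) (k : ℕ) {x : α} (hx : x ∈ robustSet p c k) :
    c ^ k ≤ Nat.card {f : Fin (k + 1) → α // f 0 = x ∧ IsPosetHom (chainRel (k + 1)) p f} := by
  classical
  induction k generalizing x with
  | zero =>
    have : Nonempty {f : Fin 1 → α // f 0 = x ∧ IsPosetHom (chainRel 1) p f} :=
      ⟨fun _ => x, rfl, fun i j hij => absurd hij (by simp [chainRel, show i = j by omega])⟩
    rw [pow_zero]
    exact_mod_cast Nat.card_pos (α := {f : Fin 1 → α // f 0 = x ∧ IsPosetHom (chainRel 1) p f})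
  | succ k ih =>
    let Y := {y // y ∈ robustSet p c k ∧ p x y}
    let C (y : α) := {f : Fin (k + 1) → α // f 0 = y ∧ IsPosetHom (chainRel (k + 1)) p f}
    have hle : Nat.card (Σ y : Y, C y) ≤ Nat.card
        {f : Fin (k + 2) → α // f 0 = x ∧ IsPosetHom (chainRel (k + 2)) p f} := by
      refine Nat.card_le_card_of_injective (fun z => ⟨Fin.cons x z.2.1, rfl,
        z.2.2.2.chain_cons hp (by rw [z.2.2.1]; exact z.1.2.2)⟩) ?_
      rintro ⟨⟨y, hy⟩, f, hf₀, hf⟩ ⟨⟨y', hy'⟩, f', hf₀', hf'⟩ h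
      obtain rfl : f = f' := Fin.cons_right_injective (α := fun _ => α) x (congrArg Subtype.val h)
      obtain rfl : y = y' := hf₀.symm.trans hf₀'
      rfl
    calc c ^ (k + 1) = c * c ^ k := pow_succ' c k
      _ ≤ Nat.card Y * c ^ k := by
        gcongr
        exact mem_robustSet_succ.1 hx
      _ = ∑ _y : Y, c ^ k := by simp [Nat.card_eq_fintype_card]
      _ ≤ ∑ y : Y, (Nat.card (C y) : ℝ) := Finset.sum_le_sum fun y _ => ih y.2.1
      _ = (Nat.card (Σ y : Y, C y) : ℝ) := by rw [Nat.card_sigma]; push_cast; rfl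
      _ ≤ _ := by exact_mod_cast hle

/-- If `robustSet p c k` is large, then `p` has many chains with `k + 1` elements. -/
lemma pow_le_card_chains {α : Type*} [Fintype α] {p : α → α → Prop} (hp : IsStrictOrd p)
    {c : ℝ} (hc : 0 ≤ c) (k : ℕ) (hk : c ≤ (robustSet p c k).card) :
    c ^ (k + 1) ≤ Nat.card {f : Fin (k + 1) → α // IsPosetHom (chainRel (k + 1)) p f} := by
  classical
  let C (x : α) := {f : Fin (k + 1) → α // f 0 = x ∧ IsPosetHom (chainRel (k + 1)) p f}
  have hle : Nat.card (Σ x : α, C x) ≤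
      Nat.card {f : Fin (k + 1) → α // IsPosetHom (chainRel (k + 1)) p f} := by
    refine Nat.card_le_card_of_injective (fun z => ⟨z.2.1, z.2.2.2⟩) ?_
    rintro ⟨y, f, rfl, hf⟩ ⟨y', f', rfl, hf'⟩ h
    obtain rfl : f = f' := congrArg Subtype.val h
    rfl
  calc c ^ (k + 1) = c * c ^ k := pow_succ' c k
    _ ≤ (robustSet p c k).card * c ^ k := by gcongr
    _ = ∑ _x ∈ robustSet p c k, c ^ k := by simp
    _ ≤ ∑ x ∈ robustSet p c k, (Nat.card (C x) : ℝ) :=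
      Finset.sum_le_sum fun x hx => pow_le_card_chains_from hp hc k hx
    _ ≤ ∑ x, (Nat.card (C x) : ℝ) :=
      Finset.sum_le_sum_of_subset_of_nonneg (Finset.subset_univ _) fun _ _ _ => Nat.cast_nonneg _
    _ = (Nat.card (Σ x, C x) : ℝ) := by rw [Nat.card_sigma]; push_cast; rfl
    _ ≤ _ := by exact_mod_cast hle

/-- If `robustSet p c k` is small, then few edges need to be removed to destroy all chains with
`k + 1` elements. -/
lemma exists_chain_free_of_card_robustSet_le {α : Type*} [Fintype α] {p : α → α → Prop}
    (hp : IsStrictOrd p) {c : ℝ} {k : ℕ} (hk : 1 ≤ k) (hc : 0 ≤ c)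
    (hcard : (robustSet p c k).card ≤ c) :
    ∃ p' : α → α → Prop, IsStrictOrd p' ∧ SubposetRel p' p ∧
      (removedEdges p p' : ℝ) ≤ 2 * c * Fintype.card α ∧ ¬ HasChain p' (k + 1) := by
  classical
  let G := robustSet p c
  let l (x : α) : ℕ := Nat.findGreatest (x ∈ G ·) k
  have hl (x : α) : x ∈ G (l x) :=
    Nat.findGreatest_spec (P := (x ∈ G ·)) (Nat.zero_le _) (by simp [G, robustSet])
  refine ⟨fun x y => p x y ∧ l y < l x ∧ x ∉ G k,
    ⟨fun x h => hp.1 x h.1, fun x y z h₁ h₂ =>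
      ⟨hp.2 h₁.1 h₂.1, h₂.2.1.trans h₁.2.1, h₁.2.2⟩⟩, fun x y h => h.1, ?_, ?_⟩
  · have hfib (x : α) :
        (Nat.card {y // p x y ∧ ¬(p x y ∧ l y < l x ∧ x ∉ G k)} : ℝ) ≤
          c + if x ∈ G k then (Fintype.card α : ℝ) else 0 := by
      split_ifs with hx
      · have : Nat.card {y // p x y ∧ ¬(p x y ∧ l y < l x ∧ x ∉ G k)} ≤ Fintype.card α := by
          rw [Nat.card_eq_fintype_card]
          exact Fintype.card_subtype_le _
        have : (Nat.card {y // p x y ∧ ¬(p x y ∧ l y < l x ∧ x ∉ G k)} : ℝ) ≤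
          Fintype.card α := by exact_mod_cast this
        linarith
      · have hlk : l x < k := lt_of_le_of_ne (Nat.findGreatest_le _) fun h => hx (h ▸ hl x)
        have hnot : x ∉ G (l x + 1) := Nat.findGreatest_is_greatest (Nat.lt_succ_self _) hlk
        rw [mem_robustSet_succ, not_le] at hnot
        rw [add_zero]
        refine le_trans ?_ hnot.le
        exact_mod_cast Nat.card_le_card_of_injective
          (fun y : {y // p x y ∧ ¬(p x y ∧ l y < l x ∧ x ∉ G k)} =>
            (⟨y.1, robustSet_antitone p c (by have := y.2; grind) (hl y.1), y.2.1⟩ :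
              {y // y ∈ G (l x) ∧ p x y}))
          fun y z h => Subtype.ext (congrArg (fun t => t.1) h)
    rw [removedEdges, card_subtype_prod_eq_sum
      (fun x y => p x y ∧ ¬(p x y ∧ l y < l x ∧ x ∉ G k)), Nat.cast_sum]
    refine (Finset.sum_le_sum fun x _ => hfib x).trans ?_
    rw [Finset.sum_add_distrib, Finset.sum_ite_mem, Finset.univ_inter]
    simp only [Finset.sum_const, nsmul_eq_mul, Finset.card_univ]
    have := mul_le_mul_of_nonneg_right hcard (Nat.cast_nonneg (α := ℝ) (Fintype.card α))
    simp only [G]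
    linarith
  · rintro ⟨f, hf⟩
    have hlow (i : ℕ) (hi : i < k + 1) : l (f ⟨i, hi⟩) + i ≤ l (f 0) := by
      induction i with
      | zero => simp
      | succ i ih =>
        have h := (hf (show (⟨i, by omega⟩ : Fin (k + 1)) < ⟨i + 1, hi⟩ by simp)).2.1
        have := ih (by omega)
        omega
    have h₀ := hlow k (Nat.lt_succ_self k)
    have hlk : l (f 0) = k := le_antisymm (Nat.findGreatest_le _) (by omega)
    refine (hf (show (0 : Fin (k + 1)) < Fin.last k from hk)).2.2 ?_
    have hmem := hl (f 0)
    rwa [hlk] at hmem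

/-- If there are many chains of height `h(Q)`, then there are many copies of `Q`. -/
lemma pow_le_homDensity {α β : Type*} [Fintype α] [Fintype β] [Nonempty α] {q : β → β → Prop}
    (hq : IsStrictOrd q) {p : α → α → Prop} (hp : IsStrictOrd p) (hw : 0 < posetWidth q)
    {δ : ℝ} (hδ : 0 ≤ δ)
    (hchain : (δ * Fintype.card α) ^ posetHeight q ≤
      Nat.card {f : Fin (posetHeight q) → α // IsPosetHom (chainRel (posetHeight q)) p f}) :
    δ ^ (posetHeight q * posetWidth q ^ 2) ≤ homDensity q p := by
  obtain ⟨ι, hι⟩ := hq.exists_embedding_chainBlowup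
  obtain ⟨n, hn⟩ := Nat.exists_eq_succ_of_ne_zero hw.ne'
  have hhom := card_hom_mul_le p ι hι
  have hblow := card_chains_pow_le hp n (posetHeight q)
  rw [hn, Nat.succ_eq_add_one] at hhom ⊢
  rw [Fintype.card_prod, Fintype.card_fin, Fintype.card_fin] at hhom
  rw [homDensity]
  generalize posetHeight q = h at *
  have hN : (0 : ℝ) < Fintype.card α := by exact_mod_cast Fintype.card_pos
  set N := Fintype.card α
  set K := Nat.card {g : Fin (n + 1) × Fin h → α // IsPosetHom (chainBlowup (n + 1) h) p g}
  set T := Nat.card {f : β → α // IsPosetHom q p f}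
  have hhom' : (K : ℝ) * (N : ℝ) ^ Fintype.card β ≤ T * (N : ℝ) ^ ((n + 1) * h) := by
    exact_mod_cast hhom
  have hK : δ ^ (h * (n + 1) ^ 2) * (N : ℝ) ^ ((n + 1) * h) ≤ K := by
    have h₁ := pow_le_pow_left₀ (by positivity) hchain ((n + 1) * (n + 1))
    replace h₁ := h₁.trans (b := (Nat.card {f : Fin h → α // IsPosetHom (chainRel h) p f} : ℝ) ^
      ((n + 1) * (n + 1))) (c := ((N : ℝ) ^ h) ^ (n * (n + 1)) * K) (by exact_mod_cast hblow)
    refine le_of_mul_le_mul_left ?_ (show (0 : ℝ) < ((N : ℝ) ^ h) ^ (n * (n + 1)) by positivity)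
    refine le_trans (le_of_eq ?_) h₁
    ring
  rw [le_div_iff₀ (by positivity)]
  refine le_of_mul_le_mul_right ?_ (show (0 : ℝ) < (N : ℝ) ^ ((n + 1) * h) by positivity)
  calc _ = δ ^ (h * (n + 1) ^ 2) * (N : ℝ) ^ ((n + 1) * h) * (N : ℝ) ^ Fintype.card β := by ring
    _ ≤ K * (N : ℝ) ^ Fintype.card β := by gcongr
    _ ≤ _ := hhom'

/-- **Polynomial removal lemma for posets** (Theorem 1).
If `t(Q,P) < (ε/2)^{h(Q)·w(Q)²}` then one can remove at most `ε·|P|²` edges from `P`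
to obtain a `C_{h(Q)}`-free (hence `Q`-free) subposet. -/
theorem poset_removal_lemma {β : Type*} {α : Type*} [Fintype β] [Fintype α]
    (q : β → β → Prop) (hq : IsStrictOrd q)
    (p : α → α → Prop) (hp : IsStrictOrd p)
    (ε : ℝ) (hε : 0 < ε)
    (hheight : 2 ≤ posetHeight q)
    (hdens : homDensity q p < (ε / 2) ^ (posetHeight q * (posetWidth q) ^ 2)) :
    ∃ p' : α → α → Prop, IsStrictOrd p' ∧ SubposetRel p' p ∧
      (removedEdges p p' : ℝ) ≤ ε * (Fintype.card α : ℝ) ^ 2 ∧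
      ¬ HasChain p' (posetHeight q) ∧ ¬ ContainsAsSubposet q p' := by
  obtain ⟨f, hf⟩ := hq.hasChain_posetHeight
  have hfree {p' : α → α → Prop} (h : ¬ HasChain p' (posetHeight q)) :
      ¬ HasChain p' (posetHeight q) ∧ ¬ ContainsAsSubposet q p' :=
    ⟨h, fun ⟨g, _, hg⟩ => h ⟨g ∘ f, fun _ _ hij => hg (hf hij)⟩⟩
  cases isEmpty_or_nonempty α with
  | inl hα =>
    refine ⟨p, hp, fun _ _ h => h, by simp [removedEdges], hfree ?_⟩
    rintro ⟨g, -⟩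
    exact hα.elim (g ⟨0, by omega⟩)
  | inr hα =>
    have hw : 0 < posetWidth q := by
      refine lt_of_lt_of_le ?_ (card_le_posetWidth (s := {f ⟨0, by omega⟩}) ?_)
      · simp
      · simpa using hq.1 _
    obtain ⟨m, hm⟩ := Nat.exists_eq_succ_of_ne_zero (show posetHeight q ≠ 0 by omega)
    have hsmall : ((robustSet p (ε / 2 * Fintype.card α) m).card : ℝ) ≤
        ε / 2 * Fintype.card α := by
      by_contra! hlarge
      refine hdens.not_ge (pow_le_homDensity hq hp hw (by positivity) ?_)
      rw [hm]
      exact pow_le_card_chains hp (by positivity) m hlarge.le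
    obtain ⟨p', hp', hsub, hrem, hchain⟩ :=
      exists_chain_free_of_card_robustSet_le hp (by omega) (by positivity) hsmall
    exact ⟨p', hp', hsub, hrem.trans_eq (by ring), hfree (by rwa [hm])⟩
end

section
/- Let h ≥ 2 be an integer, ε > 0, c > 0, and let P be a finite poset that is ε-far from being C_h-free, i.e., every subposet of P obtained by the removal of at most ε·|P|² edges contains C_h. If s = ⌈(4·log(h) + 4c + 1)/(2ε)⌉ elements of P are chosen independently and uniformly at random, then with probability at least 1 − e^{−c} there are h of the chosen elements that form a chain in P (i.e., the sample contains a copy of C_h). -/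
/-- `Reach A f k z`: the greedy descent through the sample `f`, which in round `j` moves from the
current state `w` to the least sampled element of `A j w`, is in the state `z` after `k` rounds.
It starts in the state `none`. -/
inductive Reach {α ι : Type*} [LinearOrder α] (A : ℕ → Option α → Finset α) (f : ι → α) :
    ℕ → Option α → Prop
  | zero : Reach A f 0 none
  | succ {k : ℕ} {z : Option α} (i : ι) : Reach A f k z → f i ∈ A k z →
      (∀ j, f j ∈ A k z → f i ≤ f j) → Reach A f (k + 1) (some (f i))

section Descent

variable {α ι : Type*} [LinearOrder α] {A : ℕ → Option α → Finset α}

theorem Reach.eq {f : ι → α} {k : ℕ} {z w : Option α} (hz : Reach A f k z)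
    (hw : Reach A f k w) : z = w := by
  induction hz generalizing w with
  | zero => cases hw; rfl
  | succ i hz hi hmin ih =>
    cases hw with
    | succ j hw hj hmin' =>
      obtain rfl := ih hw
      rw [le_antisymm (hmin j hj) (hmin' i hi)]

/-- The state reached only depends on the sampled elements up to that state. -/
theorem Reach.congr {f g : ι → α} {k : ℕ} {z : Option α}
    (hA : ∀ k z x, x ∈ A k (some z) → z < x) (hz : Reach A f k z)
    (hfg : ∀ i, ∀ x ∈ z, f i ≤ x ∨ g i ≤ x → f i = g i) : Reach A g k z := by
  induction hz with
  | zero => exact .zero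
  | @succ k w i hw hi hmin ih =>
    have key : ∀ j, f j ≤ f i ∨ g j ≤ f i → f j = g j := fun j => hfg j _ rfl
    have hw' : Reach A g k w := by
      refine ih fun j x hx hj => key j ?_
      have hx' : x < f i := hA k x _ (by rw [Option.mem_def] at hx; rwa [← hx])
      exact hj.imp (fun h => h.trans hx'.le) (fun h => h.trans hx'.le)
    rw [key i (.inl le_rfl)] at hi ⊢
    refine .succ i hw' hi fun j hj => ?_
    by_contra! hlt
    have hfi := key i (.inl le_rfl)
    have hfj := key j (.inr (hfi ▸ hlt.le))
    have := hmin j (hfj ▸ hj)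
    rw [hfi, hfj] at this
    exact absurd hlt this.not_gt

/-- A run of the descent either gets stuck in one of the first `h` rounds or completes them. -/
theorem exists_reach_or_stuck [Finite ι] (A : ℕ → Option α → Finset α) (f : ι → α) (h : ℕ) :
    (∃ z, Reach A f h z) ∨ ∃ k < h, ∃ z, Reach A f k z ∧ ∀ i, f i ∉ A k z := by
  induction h with
  | zero => exact .inl ⟨none, .zero⟩
  | succ h ih =>
    rcases ih with ⟨z, hz⟩ | ⟨k, hk, hz⟩
    · by_cases hs : ∃ i, f i ∈ A h z
      · obtain ⟨i, hi, hmin⟩ := Set.exists_min_image {i | f i ∈ A h z} f (Set.toFinite _) hs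
        exact .inl ⟨_, .succ i hz hi hmin⟩
      · exact .inr ⟨h, h.lt_succ_self, z, hz, not_exists.mp hs⟩
    · exact .inr ⟨k, hk.trans h.lt_succ_self, hz⟩

theorem exists_final_segment [Fintype α] (d : ℕ) (hd : d ≤ Fintype.card α) :
    ∃ B : Finset α, B.card = d ∧ ∀ x ∉ B, ∀ y ∈ B, x < y := by
  induction d with
  | zero => exact ⟨∅, by simp⟩
  | succ d ih =>
    obtain ⟨B, hB, hlt⟩ := ih (by omega)
    have hne : Bᶜ.Nonempty := by
      rw [← Finset.card_pos, Finset.card_compl]; omega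
    have hmem := Finset.max'_mem _ hne
    have hmax : ∀ x ∉ B, x ≤ Bᶜ.max' hne := fun x hx =>
      Finset.le_max' _ _ (Finset.mem_compl.mpr hx)
    generalize Bᶜ.max' hne = m at hmem hmax
    rw [Finset.mem_compl] at hmem
    refine ⟨insert m B, by rw [Finset.card_insert_of_notMem hmem, hB], fun x hx y hy => ?_⟩
    rw [Finset.mem_insert, not_or] at hx
    rcases Finset.mem_insert.mp hy with rfl | hy
    · exact (hmax x hx.2).lt_of_ne hx.1
    · exact hlt x hx.2 y hy

/-- If `B` is at most as large as `C`, both inside `U`, a permutation supported on `U` maps `B`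
into `C`. -/
theorem exists_perm_mapsTo {α : Type*} [Fintype α] [DecidableEq α] {B C U : Finset α}
    (hB : B ⊆ U) (hC : C ⊆ U) (hBC : B.card ≤ C.card) :
    ∃ σ : Equiv.Perm α, (∀ x ∉ U, σ x = x) ∧ ∀ b ∈ B, σ b ∈ C := by
  obtain ⟨C', hC', hcard⟩ := Finset.exists_subset_card_eq hBC
  have e : {u : U // u.1 ∈ B} ≃ {u : U // u.1 ∈ C'} :=
    (Equiv.subtypeSubtypeEquivSubtype fun h => hB h).trans
      ((Finset.equivOfCardEq hcard.symm).trans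
        (Equiv.subtypeSubtypeEquivSubtype fun h => hC (hC' h)).symm)
  refine ⟨Equiv.Perm.ofSubtype e.extendSubtype, fun x hx =>
    Equiv.Perm.ofSubtype_apply_of_not_mem _ hx, fun b hb => hC' ?_⟩
  rw [Equiv.Perm.ofSubtype_apply_of_mem _ (hB hb)]
  exact e.extendSubtype_mem ⟨b, hB hb⟩ hb

/-- If the candidate set in round `k` always has at least `d` elements, then at most
`(|α| - d) ^ |ι|` samples get stuck in round `k`. -/
theorem card_stuck_le [Fintype α] [Fintype ι] (hA : ∀ k z x, x ∈ A k (some z) → z < x)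
    {d k : ℕ} (hdn : d ≤ Fintype.card α)
    (hd : ∀ (f : ι → α) z, Reach A f k z → d ≤ (A k z).card) :
    Nat.card {f : ι → α // ∃ z, Reach A f k z ∧ ∀ i, f i ∉ A k z} ≤
      (Fintype.card α - d) ^ Fintype.card ι := by
  classical
  obtain ⟨B, hB, hlt⟩ := exists_final_segment (α := α) d hdn
  have hperm : ∀ z : Option α, ∃ σ : Equiv.Perm α, d ≤ (A k z).card →
      (∀ y, ∀ x ∈ z, y ≤ x → σ y = y) ∧ ∀ b ∈ B, σ b ∈ A k z := by
    intro z
    by_cases hz : d ≤ (A k z).card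
    swap
    · exact ⟨1, fun h => absurd h hz⟩
    cases z with
    | none =>
      obtain ⟨σ, -, hσ⟩ := exists_perm_mapsTo (Finset.subset_univ B)
        (Finset.subset_univ (A k none)) (hB.trans_le hz)
      exact ⟨σ, fun _ => ⟨by simp, hσ⟩⟩
    | some x =>
      let U := Finset.univ.filter (x < ·)
      have hAU : A k (some x) ⊆ U := fun y hy => by simpa [U] using hA k x y hy
      have hBU : B ⊆ U := by
        intro b hb
        by_contra hbU
        have hbx : b ≤ x := by simpa [U] using hbU
        have hsub : U ⊆ B := fun u hu => by
          by_contra huB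
          exact (hlt u huB b hb).not_ge (hbx.trans (by simpa [U] using hu : x < u).le)
        have h1 := Finset.card_lt_card (Finset.ssubset_iff_subset_ne.mpr
          ⟨hsub, fun h => hbU (h ▸ hb)⟩)
        have h2 := Finset.card_le_card hAU
        omega
      obtain ⟨σ, hfix, hσ⟩ := exists_perm_mapsTo hBU hAU (hB.trans_le hz)
      refine ⟨σ, fun _ => ⟨fun y x' hx' hy => hfix y ?_, hσ⟩⟩
      obtain rfl : x = x' := by simpa using hx'
      simpa [U] using hy
  choose σ hσ using hperm
  have hreach : ∀ (f : ι → α) z, Reach A f k z → Reach A (fun i => (σ z).symm (f i)) k z := by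
    intro f z hz
    have hfix := (hσ z (hd f z hz)).1
    refine hz.congr hA fun i x hx hi => ?_
    rcases hi with hi | hi
    · rw [Equiv.eq_symm_apply]
      exact hfix _ x hx hi
    · have := hfix _ x hx hi
      rwa [Equiv.apply_symm_apply] at this
  have hcard : Nat.card {g : ι → α // g ∈ Fintype.piFinset fun _ : ι => Bᶜ} =
      (Fintype.card α - d) ^ Fintype.card ι := by
    rw [Nat.card_eq_fintype_card, Fintype.card_coe, Fintype.card_piFinset]
    simp [Finset.card_compl, hB]
  rw [← hcard]
  refine Nat.card_le_card_of_injective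
    (fun f => ⟨fun i => (σ f.2.choose).symm (f.1 i), ?_⟩) ?_
  · obtain ⟨hz, hf⟩ := f.2.choose_spec
    rw [Fintype.mem_piFinset]
    refine fun i => Finset.mem_compl.mpr fun hi => hf i ?_
    have := (hσ _ (hd _ _ hz)).2 _ hi
    rwa [Equiv.apply_symm_apply] at this
  · intro f g hfg
    have hf := hreach _ _ f.2.choose_spec.1
    have hg := hreach _ _ g.2.choose_spec.1
    simp only [Subtype.mk.injEq] at hfg
    rw [hfg] at hf
    have hzw := hf.eq hg
    ext i
    have := congrFun hfg i
    rw [hzw] at this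
    exact (σ _).symm.injective this

end Descent

section Levels

variable {α : Type*} {p : α → α → Prop}

theorem IsStrictOrd.exists_linearOrder (hp : IsStrictOrd p) :
    ∃ _ : LinearOrder α, ∀ x y, p y x → x < y := by
  classical
  let P : PartialOrder α :=
    { le := fun x y => x = y ∨ p y x
      lt := fun x y => p y x
      le_refl := fun x => .inl rfl
      le_trans := by
        rintro x y z (rfl | h1) (rfl | h2)
        · exact .inl rfl
        · exact .inr h2
        · exact .inr h1
        · exact .inr (hp.2 h2 h1)
      le_antisymm := by
        rintro x y (rfl | h1) (h | h2)
        · rfl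
        · rfl
        · exact h.symm
        · exact absurd (hp.2 h1 h2) (hp.1 _)
      lt_iff_le_not_ge := by
        intro x y
        constructor
        · refine fun h => ⟨.inr h, ?_⟩
          rintro (rfl | h')
          · exact hp.1 _ h
          · exact hp.1 _ (hp.2 h h')
        · rintro ⟨rfl | h, h'⟩
          · exact absurd (.inl rfl) h'
          · exact h }
  refine ⟨(inferInstance : LinearOrder (LinearExtension α)), fun x y hxy => ?_⟩
  have hle : toLinearExtension x ≤ toLinearExtension y := toLinearExtension.monotone (.inr hxy)
  refine lt_of_le_of_ne hle fun h => hp.1 x ?_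
  have h' : x = y := h
  rwa [← h'] at hxy

open Classical in
/-- Everything has level at least `0`, and an element has level at least `j + 1` when it is above
at least `d` elements of level at least `j`. -/
noncomputable def levelGE [Fintype α] (p : α → α → Prop) (d j : ℕ) : Finset α :=
  (fun L => Finset.univ.filter fun x => d ≤ (L.filter (p · x)).card)^[j] Finset.univ

open Classical in
theorem mem_levelGE_succ [Fintype α] {d j : ℕ} {x : α} :
    x ∈ levelGE p d (j + 1) ↔ d ≤ ((levelGE p d j).filter (p · x)).card := by
  rw [levelGE, Function.iterate_succ_apply', Finset.mem_filter]
  simp [levelGE]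

theorem levelGE_antitone [Fintype α] (p : α → α → Prop) (d : ℕ) : Antitone (levelGE p d) := by
  classical
  refine antitone_nat_of_succ_le fun j => ?_
  induction j with
  | zero => exact Finset.subset_univ _
  | succ j ih =>
    intro x hx
    rw [mem_levelGE_succ] at hx ⊢
    exact hx.trans (Finset.card_le_card (Finset.filter_subset_filter _ ih))

/-- The edges that go up strictly in the level capped at `m`. -/
def climbing [Fintype α] (p : α → α → Prop) (d m : ℕ) (y x : α) : Prop :=
  p y x ∧ ∃ j ≤ m, x ∈ levelGE p d j ∧ y ∉ levelGE p d j

theorem climbing_isStrictOrd [Fintype α] (hp : IsStrictOrd p) (d m : ℕ) :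
    IsStrictOrd (climbing p d m) := by
  refine ⟨fun x hx => hp.1 x hx.1, ?_⟩
  rintro x y z ⟨hxy, i, hi, hyi, hxi⟩ ⟨hyz, j, hj, hzj, hyj⟩
  have hij : i ≤ j := by
    by_contra! h
    exact hyj (levelGE_antitone p d h.le hyi)
  exact ⟨hp.2 hxy hyz, i, hi, levelGE_antitone p d hij hzj, hxi⟩

theorem climbing_not_hasChain [Fintype α] (d m : ℕ) : ¬ HasChain (climbing p d m) (m + 2) := by
  rintro ⟨f, hf⟩
  have key : ∀ i (hi : i < m + 2), f ⟨i, hi⟩ ∈ levelGE p d i := by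
    intro i
    induction i with
    | zero => exact fun _ => Finset.mem_univ _
    | succ i ih =>
      intro hi
      obtain ⟨-, j, -, hj, hj'⟩ := @hf ⟨i, by omega⟩ ⟨i + 1, hi⟩ (by simp)
      refine levelGE_antitone p d ?_ hj
      by_contra! h
      exact hj' (levelGE_antitone p d (Nat.le_of_lt_succ h) (ih _))
  obtain ⟨-, j, hjm, -, hj⟩ := @hf ⟨m, by omega⟩ ⟨m + 1, by omega⟩ (by simp)
  exact hj (levelGE_antitone p d hjm (key m _))

theorem removedEdges_eq_sum [Fintype α] (p p' : α → α → Prop) :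
    removedEdges p p' = ∑ x, Nat.card {y // p y x ∧ ¬ p' y x} := by
  rw [removedEdges, ← Nat.card_sigma]
  exact Nat.card_congr
    { toFun := fun e => ⟨e.1.2, e.1.1, e.2⟩
      invFun := fun e => ⟨(e.2.1, e.1), e.2.2⟩
      left_inv := fun _ => rfl
      right_inv := fun _ => rfl }

/-- The edges that do not climb number at most `b * |α|` at elements of level at most `m` and at
most `b * |α|` at the others, where `b + 1` is the threshold that defines the levels. -/
theorem removedEdges_climbing_le [Fintype α] (b m : ℕ)
    (hm : (levelGE p (b + 1) (m + 1)).card ≤ b) :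
    removedEdges p (climbing p (b + 1) m) ≤ 2 * b * Fintype.card α := by
  classical
  set L := levelGE p (b + 1) (m + 1)
  have hx : ∀ x, Nat.card {y // p y x ∧ ¬ climbing p (b + 1) m y x} ≤
      (if x ∈ L then Fintype.card α else 0) + b := by
    intro x
    split_ifs with hxL
    · exact (Finite.card_subtype_le _).trans (by rw [Nat.card_eq_fintype_card]; omega)
    · have hex : ∃ j, x ∉ levelGE p (b + 1) (j + 1) := ⟨m, hxL⟩
      have hjm : Nat.find hex ≤ m := Nat.find_min' hex hxL
      have hj := Nat.find_spec hex
      have hmem : x ∈ levelGE p (b + 1) (Nat.find hex) := by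
        rcases hj0 : Nat.find hex with _ | i
        · exact Finset.mem_univ _
        · exact not_not.mp (Nat.find_min hex (m := i) (by omega))
      generalize Nat.find hex = j at hjm hj hmem
      rw [mem_levelGE_succ, not_le] at hj
      rw [Nat.card_eq_fintype_card, Fintype.card_subtype, zero_add]
      refine (Finset.card_le_card fun y hy => ?_).trans (Nat.le_of_lt_succ hj)
      simp only [Finset.mem_filter, Finset.mem_univ, true_and] at hy ⊢
      refine ⟨?_, hy.1⟩
      by_contra hyj
      exact hy.2 ⟨hy.1, j, hjm, hmem, hyj⟩
  rw [removedEdges_eq_sum]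
  refine (Finset.sum_le_sum fun x _ => hx x).trans ?_
  rw [Finset.sum_add_distrib, Finset.sum_ite_mem, Finset.univ_inter, Finset.sum_const,
    Finset.sum_const, Finset.card_univ, smul_eq_mul, smul_eq_mul]
  nlinarith [Nat.mul_le_mul_right (Fintype.card α) hm]

open Classical in
/-- The elements of level at least `m - k` below the current state. -/
noncomputable def candidates [Fintype α] (p : α → α → Prop) (d m k : ℕ) (z : Option α) :
    Finset α :=
  (levelGE p d (m - k)).filter fun y => ∀ x ∈ z, p y x

theorem mem_candidates [Fintype α] {d m k : ℕ} {z : Option α} {y : α} :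
    y ∈ candidates p d m k z ↔ y ∈ levelGE p d (m - k) ∧ ∀ x ∈ z, p y x := by
  simp [candidates]

theorem Reach.exists_chain {ι : Type*} [Fintype α] [LinearOrder α] (hp : IsStrictOrd p)
    {d m k : ℕ} {f : ι → α} {z : Option α} (hz : Reach (candidates p d m) f k z) :
    ∃ g : Fin k → ι, (∀ i j, i < j → p (f (g i)) (f (g j))) ∧
      ∀ i, ∀ x ∈ z, x = f (g i) ∨ p x (f (g i)) := by
  induction hz with
  | zero => exact ⟨Fin.elim0, fun i => i.elim0, fun i => i.elim0⟩
  | @succ k w i hw hi hmin ih =>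
    obtain ⟨g, hg, hgw⟩ := ih
    have hlow : ∀ j, p (f i) (f (g j)) := by
      intro j
      cases hw with
      | zero => exact j.elim0
      | succ i' _ _ _ =>
        have hii' : p (f i) (f i') := (mem_candidates.mp hi).2 _ rfl
        rcases hgw j _ rfl with h | h
        · rwa [← h]
        · exact hp.2 hii' h
    refine ⟨Fin.cons i g, fun a b => ?_, fun a => ?_⟩
    · refine Fin.cases ?_ (fun a => ?_) a <;> refine Fin.cases ?_ (fun b => ?_) b
      · simp
      · simpa using hlow b
      · simp
      · simpa using hg a b
    · refine Fin.cases ?_ (fun a => ?_) a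
      · simp [eq_comm]
      · simpa using .inr (hlow a)

theorem Reach.le_card_candidates {ι : Type*} [Fintype α] [LinearOrder α] {d m k : ℕ}
    (hd : d ≤ (levelGE p d m).card) (hk : k ≤ m) {f : ι → α} {z : Option α}
    (hz : Reach (candidates p d m) f k z) : d ≤ (candidates p d m k z).card := by
  classical
  cases hz with
  | zero => simpa [candidates] using hd
  | @succ k w i hw hi hmin =>
    have hmem := (mem_candidates.mp hi).1
    rw [show m - k = m - (k + 1) + 1 by omega, mem_levelGE_succ] at hmem
    simpa [candidates] using hmem

/-- If at least `d` elements have level at least `m`, then at most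
`(m + 1) * (|α| - d) ^ |ι|` samples contain no chain of `m + 1` elements. -/
theorem card_no_chain_le {ι : Type*} [Fintype α] [Fintype ι] (hp : IsStrictOrd p) {d m : ℕ}
    (hd : d ≤ (levelGE p d m).card) :
    Nat.card {f : ι → α // ¬ ∃ g : Fin (m + 1) → ι, ∀ i j, i < j → p (f (g i)) (f (g j))} ≤
      (m + 1) * (Fintype.card α - d) ^ Fintype.card ι := by
  obtain ⟨L, hL⟩ := hp.exists_linearOrder
  classical
  let stuck (k : ℕ) : Finset (ι → α) := Finset.univ.filter fun f =>
    ∃ z, Reach (candidates p d m) f k z ∧ ∀ i, f i ∉ candidates p d m k z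
  have hstuck : ∀ k ∈ Finset.range (m + 1),
      (stuck k).card ≤ (Fintype.card α - d) ^ Fintype.card ι := by
    intro k hk
    rw [← Fintype.card_subtype, ← Nat.card_eq_fintype_card]
    refine card_stuck_le (fun k z x hx => hL z x ((mem_candidates.mp hx).2 z rfl))
      (hd.trans (Finset.card_le_univ _)) fun f z hz => ?_
    exact hz.le_card_candidates hd (Finset.mem_range_succ_iff.mp hk)
  rw [Nat.card_eq_fintype_card, Fintype.card_subtype]
  calc _ ≤ ((Finset.range (m + 1)).biUnion stuck).card := by
        refine Finset.card_le_card fun f hf => ?_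
        rcases exists_reach_or_stuck (candidates p d m) f (m + 1) with ⟨z, hz⟩ | ⟨k, hk, hz⟩
        · obtain ⟨g, hg, -⟩ := hz.exists_chain hp
          exact absurd ⟨g, hg⟩ (Finset.mem_filter.mp hf).2
        · exact Finset.mem_biUnion.mpr ⟨k, Finset.mem_range.mpr hk, by simpa [stuck] using hz⟩
    _ ≤ _ := by simpa using Finset.card_biUnion_le_card_mul _ _ _ hstuck

end Levels

/-- **The subposet test** (Theorem 4). If `P` is `ε`-far from being `C_h`-free, then
`⌈(4·log h + 4c + 1)/(2ε)⌉` elements chosen independently and uniformly at random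
contain a copy of `C_h` with probability at least `1 - e^{-c}`. -/
theorem subposet_test {α : Type*} [Fintype α] (p : α → α → Prop) (hp : IsStrictOrd p)
    (h : ℕ) (hh : 2 ≤ h) (ε c : ℝ) (hε : 0 < ε) (hc : 0 < c)
    (hfar : ∀ p' : α → α → Prop, IsStrictOrd p' → SubposetRel p' p →
      (removedEdges p p' : ℝ) ≤ ε * (Fintype.card α : ℝ) ^ 2 → HasChain p' h) :
    1 - Real.exp (-c) ≤
      (Nat.card {f : Fin ⌈(4 * Real.log h + 4 * c + 1) / (2 * ε)⌉₊ → α //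
          ∃ g : Fin h → Fin ⌈(4 * Real.log h + 4 * c + 1) / (2 * ε)⌉₊,
            ∀ i j : Fin h, i < j → p (f (g i)) (f (g j))} : ℝ) /
        (Fintype.card α : ℝ) ^ (⌈(4 * Real.log h + 4 * c + 1) / (2 * ε)⌉₊ : ℕ) := by
  classical
  obtain ⟨m, rfl⟩ : ∃ m, h = m + 2 := ⟨h - 2, by omega⟩
  have hn : 0 < Fintype.card α := by
    obtain ⟨f, -⟩ := hfar p hp (fun _ _ => id) (by
      have : removedEdges p p = 0 := by simp [removedEdges]
      rw [this]; push_cast; positivity)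
    exact Fintype.card_pos_iff.mpr ⟨f 0⟩
  have hn' : (0 : ℝ) < Fintype.card α := by exact_mod_cast hn
  set d := ⌈ε / 2 * Fintype.card α⌉₊ with hd
  have hle : ε / 2 * Fintype.card α ≤ d := Nat.le_ceil _
  have hdcard : d ≤ (levelGE p d (m + 1)).card := by
    obtain ⟨b, hb⟩ : ∃ b, d = b + 1 := Nat.exists_eq_succ_of_ne_zero
      (Nat.ceil_pos.mpr (by positivity)).ne'
    have hbn : (b : ℝ) < ε / 2 * Fintype.card α := Nat.lt_ceil.mp (by omega)
    rw [hb]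
    by_contra! hlt
    refine climbing_not_hasChain (p := p) (b + 1) m (hfar _ (climbing_isStrictOrd hp _ _)
      (fun _ _ hxy => hxy.1) ?_)
    calc (removedEdges p (climbing p (b + 1) m) : ℝ)
        ≤ 2 * b * Fintype.card α := by
          exact_mod_cast removedEdges_climbing_le b m (Nat.le_of_lt_succ hlt)
      _ ≤ ε * (Fintype.card α : ℝ) ^ 2 := by nlinarith
  have hdn : d ≤ Fintype.card α := hdcard.trans (Finset.card_le_univ _)
  set s := ⌈(4 * Real.log (m + 2 : ℕ) + 4 * c + 1) / (2 * ε)⌉₊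
  have hs : Real.log (m + 2 : ℕ) + c ≤ ε / 2 * s := by
    have h1 := Nat.le_ceil ((4 * Real.log (m + 2 : ℕ) + 4 * c + 1) / (2 * ε))
    rw [div_le_iff₀ (by positivity)] at h1
    linarith
  have hbad := card_no_chain_le (ι := Fin s) hp hdcard
  rw [Fintype.card_fin] at hbad
  have hbad' : (Nat.card {f : Fin s → α // ¬ ∃ g : Fin (m + 2) → Fin s,
      ∀ i j, i < j → p (f (g i)) (f (g j))} : ℝ) ≤
      Real.exp (-c) * (Fintype.card α : ℝ) ^ s := by
    calc _ ≤ ((m + 2 : ℕ) : ℝ) * ((Fintype.card α : ℝ) - d) ^ s := by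
          rw [← Nat.cast_sub hdn]
          exact_mod_cast hbad
      _ ≤ ((m + 2 : ℕ) : ℝ) * (Real.exp (-(ε / 2)) * Fintype.card α) ^ s := by
          have h0 : (0 : ℝ) ≤ (Fintype.card α : ℝ) - d := by
            rw [sub_nonneg]; exact_mod_cast hdn
          gcongr
          nlinarith [Real.add_one_le_exp (-(ε / 2))]
      _ = Real.exp (Real.log (m + 2 : ℕ) - ε / 2 * s) * (Fintype.card α : ℝ) ^ s := by
          rw [mul_pow, ← Real.exp_nat_mul, sub_eq_add_neg, Real.exp_add,
            Real.exp_log (by positivity)]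
          ring_nf
      _ ≤ _ := by
          gcongr
          linarith
  have htotal : Nat.card {f : Fin s → α // ∃ g : Fin (m + 2) → Fin s,
        ∀ i j, i < j → p (f (g i)) (f (g j))} +
      Nat.card {f : Fin s → α // ¬ ∃ g : Fin (m + 2) → Fin s,
        ∀ i j, i < j → p (f (g i)) (f (g j))} = Fintype.card α ^ s := by
    rw [← Nat.card_sum, Nat.card_congr (Equiv.sumCompl _), Nat.card_eq_fintype_card]
    simp
  have htotal' := congrArg (Nat.cast (R := ℝ)) htotal
  push_cast at htotal'
  rw [le_div_iff₀ (by positivity)]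
  linarith
end

section
/- For every finite poset P and every integer h ≥ 2, there exists a C_h-free subposet of P obtained by the removal of at most |P|²/(2h−2) edges. In other words, every poset is 1/(2h−2)-close to being C_h-free. -/
/-- A finite strict order embeds increasingly in an initial segment of the naturals. -/
theorem IsStrictOrd.exists_rank {α : Type*} [Fintype α] {p : α → α → Prop}
    (hp : IsStrictOrd p) :
    ∃ f : α → ℕ, Function.Injective f ∧ (∀ x, f x < Fintype.card α) ∧
      ∀ ⦃x y⦄, p x y → f x < f y := by
  let _ : PartialOrder α :=
    { le := fun x y => x = y ∨ p x y
      le_refl := fun _ => Or.inl rfl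
      le_trans := by
        rintro x y z (rfl | hxy) (rfl | hyz)
        · exact Or.inl rfl
        · exact Or.inr hyz
        · exact Or.inr hxy
        · exact Or.inr (hp.2 hxy hyz)
      le_antisymm := by
        rintro x y (rfl | hxy) (h | hyx)
        · rfl
        · rfl
        · exact h.symm
        · exact (hp.1 x (hp.2 hxy hyx)).elim }
  let _ : Fintype (LinearExtension α) := ‹Fintype α›
  let e : LinearExtension α ≃o Fin (Fintype.card α) := (Fintype.orderIsoFinOfCardEq _ rfl).symm
  have hinj : Function.Injective fun x : α => (e (toLinearExtension x) : ℕ) :=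
    fun x y hxy => e.injective (Fin.ext hxy)
  refine ⟨_, hinj, fun x => (e _).2, fun x y hxy => ?_⟩
  have hle : (e (toLinearExtension x) : ℕ) ≤ e (toLinearExtension y) :=
    e.monotone (toLinearExtension.monotone (Or.inr hxy))
  refine hle.lt_of_ne fun h => ?_
  obtain rfl := hinj h
  exact hp.1 x hxy

theorem two_mul_sum_range_mod_add (s n : ℕ) :
    2 * ∑ j ∈ Finset.range n, j % (s + 1) + n % (s + 1) * (s + 1 - n % (s + 1)) = n * s := by
  induction n with
  | zero => simp
  | succ n ih =>
    have hb : n % (s + 1) < s + 1 := Nat.mod_lt _ s.succ_pos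
    rw [Finset.sum_range_succ]
    by_cases hs : n % (s + 1) = s
    · have h0 : (n + 1) % (s + 1) = 0 := by
        rw [← Nat.div_add_mod n (s + 1), hs, add_assoc]
        simp
      rw [hs, Nat.add_sub_cancel_left] at ih
      rw [h0, hs]
      linarith
    · have h1 : (n + 1) % (s + 1) = n % (s + 1) + 1 := by
        rw [Nat.add_mod, Nat.mod_eq_of_lt (a := 1) (by omega), Nat.mod_eq_of_lt (by omega)]
      rw [h1]
      generalize n % (s + 1) = b at *
      obtain ⟨c, rfl⟩ : ∃ c, s = b + 1 + c := ⟨s - (b + 1), by omega⟩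
      have e1 : b + 1 + c + 1 - b = c + 2 := by omega
      have e2 : b + 1 + c + 1 - (b + 1) = c + 1 := by omega
      rw [e1] at ih
      rw [e2]
      linarith

theorem two_mul_sum_range_mod_le (s n : ℕ) :
    2 * ∑ j ∈ Finset.range n, j % (s + 1) ≤ n * s :=
  le_of_add_le_left (two_mul_sum_range_mod_add s n).le

/-- Keep only the edges joining distinct blocks of `m` consecutive ranks; every removed edge is
determined by the rank of its upper end and the residue of its lower one. -/
theorem removedEdges_le_sum_mod {α : Type*} [Fintype α] {p : α → α → Prop} {f : α → ℕ}
    {n : ℕ} (m : ℕ) (hinj : Function.Injective f) (hlt : ∀ x, f x < n)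
    (hmono : ∀ ⦃x y⦄, p x y → f x < f y) :
    removedEdges p (fun x y => p x y ∧ f x / m < f y / m) ≤
      ∑ j ∈ Finset.range n, j % m := by
  have key : ∀ x y, p x y → ¬ (p x y ∧ f x / m < f y / m) → f x / m = f y / m :=
    fun x y hxy hn =>
      le_antisymm (Nat.div_le_div_right (hmono hxy).le) (not_lt.1 fun h => hn ⟨hxy, h⟩)
  let T := (Finset.range n).sigma fun j => Finset.range (j % m)
  have hT : Nat.card T = ∑ j ∈ Finset.range n, j % m := by
    rw [Nat.card_eq_fintype_card, Fintype.card_coe, Finset.card_sigma]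
    simp
  rw [← hT]
  refine Nat.card_le_card_of_injective
    (fun e => ⟨⟨f e.1.2, f e.1.1 % m⟩, ?_⟩) ?_
  · obtain ⟨⟨x, y⟩, hxy, hn⟩ := e
    have hdiv := key x y hxy hn
    have hx := Nat.div_add_mod (f x) m
    have hy := Nat.div_add_mod (f y) m
    rw [hdiv] at hx
    have hfxy : f x < f y := hmono hxy
    simp only [T, Finset.mem_sigma, Finset.mem_range]
    exact ⟨hlt y, by omega⟩
  · rintro ⟨⟨x, y⟩, hxy, hn⟩ ⟨⟨x', y'⟩, hxy', hn'⟩ h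
    simp only [Subtype.mk.injEq, Sigma.mk.injEq, heq_eq_eq] at h
    obtain ⟨hy, hmod⟩ := h
    obtain rfl := hinj hy
    have hdiv : f x / m = f x' / m := (key x y hxy hn).trans (key x' y hxy' hn').symm
    have hx : f x = f x' := by rw [← Nat.div_add_mod (f x) m, hdiv, hmod, Nat.div_add_mod]
    obtain rfl := hinj hx
    rfl

theorem not_hasChain_of_lt {α : Type*} {p : α → α → Prop} {h k : ℕ} (c : α → ℕ)
    (hc : ∀ x, c x < k) (hmono : ∀ ⦃x y⦄, p x y → c x < c y) (hk : k < h) :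
    ¬ HasChain p h := by
  rintro ⟨g, hg⟩
  have hstrict : StrictMono fun i => (⟨c (g i), hc _⟩ : Fin k) := fun i j hij => hmono (hg hij)
  have := Fintype.card_le_of_injective _ hstrict.injective
  simp only [Fintype.card_fin] at this
  omega

/-- Every poset is `1/(2h-2)`-close to being `C_h`-free: one can remove at most
`|P|²/(2h-2)` edges to obtain a `C_h`-free subposet. -/
theorem close_to_chain_free {α : Type*} [Fintype α] (p : α → α → Prop)
    (hp : IsStrictOrd p) (h : ℕ) (hh : 2 ≤ h) :
    ∃ p' : α → α → Prop, IsStrictOrd p' ∧ SubposetRel p' p ∧ ¬ HasChain p' h ∧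
      (removedEdges p p' : ℝ) ≤ (Fintype.card α : ℝ) ^ 2 / (2 * (h : ℝ) - 2) := by
  obtain ⟨f, hinj, hlt, hmono⟩ := hp.exists_rank
  obtain ⟨k, rfl⟩ : ∃ k, h = k + 1 := ⟨h - 1, by omega⟩
  have hk : 0 < k := by omega
  set n := Fintype.card α
  refine ⟨fun x y => p x y ∧ f x / (n / k + 1) < f y / (n / k + 1),
    ⟨fun x hx => hp.1 x hx.1, fun x y z hxy hyz => ⟨hp.2 hxy.1 hyz.1, hxy.2.trans hyz.2⟩⟩,
    fun x y hxy => hxy.1, ?_, ?_⟩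
  · refine not_hasChain_of_lt (k := k) (fun x => f x / (n / k + 1)) (fun x => ?_)
      (fun x y hxy => hxy.2) k.lt_succ_self
    rw [Nat.div_lt_iff_lt_mul (Nat.succ_pos _)]
    exact (hlt x).trans (Nat.lt_mul_div_succ n hk)
  · have hcard := removedEdges_le_sum_mod (p := p) (n / k + 1) hinj hlt hmono
    have htwo : 2 * removedEdges p (fun x y => p x y ∧ f x / (n / k + 1) < f y / (n / k + 1)) ≤
        n * (n / k) := (Nat.mul_le_mul_left 2 hcard).trans (two_mul_sum_range_mod_le _ _)
    have hmul := Nat.mul_le_mul_right k htwo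
    rw [mul_assoc n] at hmul
    replace hmul := hmul.trans (Nat.mul_le_mul_left n (Nat.div_mul_le_self n k))
    have hkR : (0 : ℝ) < k := by exact_mod_cast hk
    rw [le_div_iff₀ (by push_cast; linarith)]
    have : ((2 * removedEdges p (fun x y => p x y ∧ f x / (n / k + 1) < f y / (n / k + 1)) * k
        : ℕ) : ℝ) ≤ ((n * n : ℕ) : ℝ) := by exact_mod_cast hmul
    push_cast at this ⊢
    linarith
end

section
/- For every finite poset P and all positive integers h and w, the inequality t(K_{h×w}, P) ≥ t(C_h, P)^{w²} holds. -/
/-- The complete `h`-partite poset `K_{h×w}` with all `h` classes of size `w`: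
`(i,a) ≺ (j,b)` iff `i < j`. -/
def KhwRel (h w : ℕ) : (Fin h × Fin w) → (Fin h × Fin w) → Prop :=
  fun x y => x.1 < y.1

theorem card_pow_le_card_forall {X Y : Type*} [Fintype X] [Fintype Y] (R : X → Y → Prop) (k : ℕ) :
    Nat.card {q : X × Y // R q.1 q.2} ^ (k + 1) ≤
      Fintype.card X ^ k *
        Nat.card {q : X × (Fin (k + 1) → Y) // ∀ a, R q.1 (q.2 a)} := by
  classical
  have h₁ : Nat.card {q : X × Y // R q.1 q.2} = ∑ x, Nat.card {y // R x y} := by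
    rw [Nat.card_congr (Equiv.subtypeProdEquivSigmaSubtype R), Nat.card_sigma]
  have h₂ : Nat.card {q : X × (Fin (k + 1) → Y) // ∀ a, R q.1 (q.2 a)} =
      ∑ x, Nat.card {y // R x y} ^ (k + 1) := by
    rw [Nat.card_congr (Equiv.subtypeProdEquivSigmaSubtype
      fun x (ys : Fin (k + 1) → Y) => ∀ a, R x (ys a)), Nat.card_sigma]
    refine Finset.sum_congr rfl fun x _ => ?_
    rw [Nat.card_congr (Equiv.subtypePiEquivPi (p := fun _ y => R x y)), Nat.card_pi]
    simp
  rw [h₁, h₂]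
  simpa using pow_sum_le_card_mul_sum_pow (s := Finset.univ)
    (f := fun x => Nat.card {y // R x y}) (fun _ _ => Nat.zero_le _) k

/-- The number of homomorphisms from `K_{w,w}` to a bipartite relation is at least the number
expected in a random relation of the same density. -/
theorem card_pow_sq_le_card_forall_forall {X Y : Type*} [Fintype X] [Fintype Y]
    (R : X → Y → Prop) (k : ℕ) :
    Nat.card {q : X × Y // R q.1 q.2} ^ ((k + 1) ^ 2) ≤
      (Fintype.card X * Fintype.card Y) ^ (k * (k + 1)) *
        Nat.card {q : (Fin (k + 1) → Y) × (Fin (k + 1) → X) // ∀ b a, R (q.2 b) (q.1 a)} := by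
  have h₁ := card_pow_le_card_forall R k
  have h₂ := card_pow_le_card_forall
    (fun (ys : Fin (k + 1) → Y) (x : X) => ∀ a, R x (ys a)) k
  have hswap : Nat.card {q : X × (Fin (k + 1) → Y) // ∀ a, R q.1 (q.2 a)} =
      Nat.card {q : (Fin (k + 1) → Y) × X // ∀ a, R q.2 (q.1 a)} :=
    Nat.card_congr ((Equiv.prodComm _ _).subtypeEquiv fun _ => Iff.rfl)
  rw [← hswap, Fintype.card_fun, Fintype.card_fin] at h₂
  calc
    _ = (Nat.card {q : X × Y // R q.1 q.2} ^ (k + 1)) ^ (k + 1) := by rw [← pow_mul, sq]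
    _ ≤ _ := Nat.pow_le_pow_left h₁ (k + 1)
    _ = (Fintype.card X ^ k) ^ (k + 1) * _ := mul_pow _ _ _
    _ ≤ _ := Nat.mul_le_mul_left _ h₂
    _ = _ := by ring

/-- Interleaving `w` partial maps on the elements of `Fin h` satisfying `s` with `w` partial maps
on the others yields a homomorphism from `K_{h×w}`, if all combinations are chains and `s`
alternates along `Fin h`. -/
theorem isPosetHom_khwRel {α : Type*} {p : α → α → Prop}
    (htrans : ∀ ⦃x y z⦄, p x y → p y z → p x z) {h w : ℕ}
    (x : Fin w → {i : Fin h // Even (i : ℕ)} → α)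
    (y : Fin w → {i : Fin h // ¬ Even (i : ℕ)} → α)
    (hxy : ∀ a b, IsPosetHom (chainRel h) p
      ((Equiv.piEquivPiSubtypeProd (fun i : Fin h => Even (i : ℕ)) fun _ => α).symm (x a, y b))) :
    IsPosetHom (KhwRel h w) p fun ia =>
      (Equiv.piEquivPiSubtypeProd (fun i : Fin h => Even (i : ℕ)) fun _ => α).symm
        (x ia.2, y ia.2) ia.1 := by
  have key : ∀ (i j : Fin h) (a b : Fin w), i < j → (Even (i : ℕ) ↔ ¬ Even (j : ℕ)) →
      p ((Equiv.piEquivPiSubtypeProd (fun i : Fin h => Even (i : ℕ)) fun _ => α).symm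
          (x a, y a) i)
        ((Equiv.piEquivPiSubtypeProd (fun i : Fin h => Even (i : ℕ)) fun _ => α).symm
          (x b, y b) j) := by
    intro i j a b hij hpar
    by_cases hi : Even (i : ℕ)
    · have hj := hpar.1 hi
      simpa [Equiv.piEquivPiSubtypeProd, hi, hj] using hxy a b hij
    · have hj : Even (j : ℕ) := by tauto
      simpa [Equiv.piEquivPiSubtypeProd, hi, hj] using hxy b a hij
  rintro ⟨i, a⟩ ⟨j, b⟩ hij
  replace hij : i < j := hij
  by_cases hpar : Even (i : ℕ) ↔ ¬ Even (j : ℕ)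
  · exact key i j a b hij hpar
  · have hlt : (i : ℕ) + 1 < j := by
      rcases Nat.lt_or_ge ((i : ℕ) + 1) j with hlt | hge
      · exact hlt
      · exfalso
        have heq : (j : ℕ) = i + 1 := by have : (i : ℕ) < j := hij; omega
        rw [heq, Nat.even_add_one] at hpar
        tauto
    let m : Fin h := ⟨i + 1, hlt.trans j.isLt⟩
    have hm : Even (m : ℕ) ↔ ¬ Even (i : ℕ) := Nat.even_add_one
    exact htrans (key i m a a (Nat.lt_succ_self _) (by tauto)) (key m j a b hlt (by tauto))

/-- **Lemma 7**. For every finite poset `P` and positive integers `h, w`,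
`t(K_{h×w}, P) ≥ t(C_h, P)^{w²}`. -/
theorem khw_density_bound {α : Type*} [Fintype α] (p : α → α → Prop)
    (hp : IsStrictOrd p) (h w : ℕ) (hh : 0 < h) (hw : 0 < w) :
    homDensity (chainRel h) p ^ (w ^ 2) ≤ homDensity (KhwRel h w) p := by
  classical
  obtain ⟨k, rfl⟩ := Nat.exists_eq_succ_of_ne_zero hw.ne'
  rw [Nat.succ_eq_add_one]
  let e := Equiv.piEquivPiSubtypeProd (fun i : Fin h => Even (i : ℕ)) fun _ => α
  have hcard : Fintype.card ({i : Fin h // Even (i : ℕ)} → α) *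
      Fintype.card ({i : Fin h // ¬ Even (i : ℕ)} → α) = Fintype.card α ^ h := by
    rw [← Fintype.card_prod, ← Fintype.card_congr e, Fintype.card_fun, Fintype.card_fin]
  have hchain : Nat.card {f : Fin h → α // IsPosetHom (chainRel h) p f} =
      Nat.card {q : ({i : Fin h // Even (i : ℕ)} → α) × ({i : Fin h // ¬ Even (i : ℕ)} → α) //
        IsPosetHom (chainRel h) p (e.symm (q.1, q.2))} :=
    Nat.card_congr (e.subtypeEquiv fun f => by simp)
  have hbound := card_pow_sq_le_card_forall_forall
    (fun x y => IsPosetHom (chainRel h) p (e.symm (x, y))) k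
  rw [hcard, ← hchain] at hbound
  have hinj : Nat.card {q : (Fin (k + 1) → {i : Fin h // ¬ Even (i : ℕ)} → α) ×
        (Fin (k + 1) → {i : Fin h // Even (i : ℕ)} → α) //
          ∀ b a, IsPosetHom (chainRel h) p (e.symm (q.2 b, q.1 a))} ≤
      Nat.card {f : Fin h × Fin (k + 1) → α // IsPosetHom (KhwRel h (k + 1)) p f} := by
    refine Nat.card_le_card_of_injective
      (fun q => ⟨_, isPosetHom_khwRel hp.2 q.1.2 q.1.1 q.2⟩) ?_
    rintro ⟨⟨y, x⟩, _⟩ ⟨⟨y', x'⟩, _⟩ heq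
    have hfun : ∀ a, (x a, y a) = (x' a, y' a) := fun a =>
      e.symm.injective (funext fun i => congrFun (congrArg Subtype.val heq) (i, a))
    simp only [Prod.mk.injEq] at hfun
    simp only [Subtype.mk.injEq, Prod.mk.injEq]
    exact ⟨funext fun a => (hfun a).2, funext fun a => (hfun a).1⟩
  replace hbound := hbound.trans (Nat.mul_le_mul_left _ hinj)
  unfold homDensity
  rw [Fintype.card_prod, Fintype.card_fin, Fintype.card_fin]
  rcases Nat.eq_zero_or_pos (Fintype.card α) with h0 | hpos
  · simp [h0, hh.ne']
  · have hposR : (0 : ℝ) < Fintype.card α := by exact_mod_cast hpos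
    rw [div_pow, div_le_div_iff₀ (by positivity) (by positivity)]
    have hboundR : (Nat.card {f : Fin h → α // IsPosetHom (chainRel h) p f} : ℝ) ^ ((k + 1) ^ 2) ≤
        ((Fintype.card α : ℝ) ^ h) ^ (k * (k + 1)) *
          Nat.card {f : Fin h × Fin (k + 1) → α // IsPosetHom (KhwRel h (k + 1)) p f} := by
      exact_mod_cast hbound
    refine (mul_le_mul_of_nonneg_right hboundR (by positivity)).trans_eq ?_
    ring
end

section
/- Let h and w be positive integers and let L denote the complete h-partite poset K_{w_1,…,w_h} with w_i = w for odd i and w_i = 1 for even i. Then for every finite poset P, t(L, P) ≥ t(C_h, P)^w. -/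
/-- Class sizes of the complete multipartite poset `K_{w,1,w,1,…}`:
size `w` on odd (1-indexed) layers, i.e. even 0-indexed layers, size `1` otherwise. -/
def altSizes (w : ℕ) {h : ℕ} (i : Fin h) : ℕ := if i.val % 2 = 0 then w else 1

/-- The complete `h`-partite poset `K_{w,1,w,1,…}`: `x ≺ y` iff the class of `x`
is below the class of `y`. -/
def altRel (h w : ℕ) : (Σ i : Fin h, Fin (altSizes w i)) →
    (Σ i : Fin h, Fin (altSizes w i)) → Prop :=
  fun x y => x.1 < y.1

/-- The size-one classes of the alternating poset, as a type of indices. -/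
abbrev SingletonClass (h : ℕ) : Type := {i : Fin h // i.val % 2 ≠ 0}

/-- The restriction of a chain in `p` to the indices of the size-one classes. -/
def chainTrace {α : Type*} {p : α → α → Prop} {h : ℕ}
    (f : {f : Fin h → α // IsPosetHom (chainRel h) p f}) : SingletonClass h → α :=
  fun i => f.1 i.1

lemma altSizes_le {h w : ℕ} (hw : 0 < w) (i : Fin h) : altSizes w i ≤ w := by
  unfold altSizes; split <;> omega

lemma altSizes_pos {h w : ℕ} (hw : 0 < w) (i : Fin h) : 0 < altSizes w i := by
  unfold altSizes; split <;> omega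

lemma card_alt_add {h w : ℕ} (hw : 0 < w) :
    Fintype.card (Σ i : Fin h, Fin (altSizes w i)) +
      Fintype.card (SingletonClass h) * (w - 1) = h * w := by
  have hsum : ∀ i : Fin h, altSizes w i + (if i.val % 2 ≠ 0 then w - 1 else 0) = w := by
    intro i; unfold altSizes; split_ifs <;> omega
  have := Finset.sum_congr (rfl : (Finset.univ : Finset (Fin h)) = _) fun i _ => hsum i
  rw [Finset.sum_add_distrib, ← Finset.sum_filter] at this
  simpa [Fintype.card_subtype] using this

/-- Gluing `w` chains which agree on the size-one classes gives a map on the alternating poset. -/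
def glueChains {α : Type*} {p : α → α → Prop} {h w : ℕ} (hw : 0 < w)
    (g : Fin w → {f : Fin h → α // IsPosetHom (chainRel h) p f}) :
    (Σ i : Fin h, Fin (altSizes w i)) → α :=
  fun y => (g (Fin.castLE (altSizes_le hw y.1) y.2)).1 y.1

lemma isPosetHom_glueChains {α : Type*} {p : α → α → Prop} (hp : IsStrictOrd p) {h w : ℕ}
    (hw : 0 < w) (g : Fin w → {f : Fin h → α // IsPosetHom (chainRel h) p f})
    (hg : ∀ k l, chainTrace (g k) = chainTrace (g l)) :
    IsPosetHom (altRel h w) p (glueChains hw g) := by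
  rintro ⟨i, a⟩ ⟨j, b⟩ (hij : i < j)
  have agree : ∀ (m : Fin h) (k l : Fin w), m.val % 2 ≠ 0 → (g k).1 m = (g l).1 m :=
    fun m k l hm => congrFun (hg k l) ⟨m, hm⟩
  simp only [glueChains]
  generalize Fin.castLE (altSizes_le hw i) a = k
  generalize Fin.castLE (altSizes_le hw j) b = l
  by_cases hi : i.val % 2 = 0
  · have hlt : i.val < j.val := hij
    let m : Fin h := ⟨i.val + 1, by omega⟩
    have him : p ((g k).1 i) ((g l).1 m) := by
      rw [agree m l k (by simp only [m]; omega)]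
      exact (g k).2 (show i < m from Nat.lt_succ_self _)
    rcases (show m ≤ j from hlt).eq_or_lt with hmj | hmj
    · rwa [hmj] at him
    · exact hp.2 him ((g l).2 hmj)
  · rw [agree i k l hi]
    exact (g l).2 hij

lemma sum_card_chainTrace_pow_le {α : Type*} [Fintype α] {p : α → α → Prop}
    (hp : IsStrictOrd p) {h w : ℕ} (hw : 0 < w) :
    ∑ x : SingletonClass h → α,
        Nat.card {f : {f : Fin h → α // IsPosetHom (chainRel h) p f} // chainTrace f = x} ^ w ≤
      Nat.card {f : (Σ i : Fin h, Fin (altSizes w i)) → α // IsPosetHom (altRel h w) p f} := by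
  let Φ : (Σ x : SingletonClass h → α, (Fin w →
      {f : {f : Fin h → α // IsPosetHom (chainRel h) p f} // chainTrace f = x})) →
      {f : (Σ i : Fin h, Fin (altSizes w i)) → α // IsPosetHom (altRel h w) p f} :=
    fun y => ⟨glueChains hw fun k => (y.2 k).1,
      isPosetHom_glueChains hp hw _ fun k l => (y.2 k).2.trans (y.2 l).2.symm⟩
  have hΦ : Function.Injective Φ := by
    rintro ⟨x, g⟩ ⟨x', g'⟩ hxy
    have key : ∀ (i : Fin h) (a : Fin (altSizes w i)),
        (g (Fin.castLE (altSizes_le hw i) a)).1.1 i =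
          (g' (Fin.castLE (altSizes_le hw i) a)).1.1 i :=
      fun i a => congrFun (congrArg Subtype.val hxy) ⟨i, a⟩
    have hx : x = x' := by
      funext i
      have := key i.1 ⟨0, altSizes_pos hw _⟩
      rw [← (g (Fin.castLE (altSizes_le hw i.1) ⟨0, altSizes_pos hw _⟩)).2,
        ← (g' (Fin.castLE (altSizes_le hw i.1) ⟨0, altSizes_pos hw _⟩)).2]
      exact this
    subst hx
    congr 1
    funext k
    apply Subtype.ext
    apply Subtype.ext
    funext i
    by_cases hi : i.val % 2 = 0
    · exact key i ⟨k.val, by simp [altSizes, hi]⟩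
    · exact congrFun ((g k).2.trans (g' k).2.symm) ⟨i, hi⟩
  have := Nat.card_le_card_of_injective Φ hΦ
  simpa [Nat.card_sigma, Nat.card_fun] using this

lemma sum_card_chainTrace {α : Type*} [Fintype α] (p : α → α → Prop) (h : ℕ) :
    ∑ x : SingletonClass h → α,
        Nat.card {f : {f : Fin h → α // IsPosetHom (chainRel h) p f} // chainTrace f = x} =
      Nat.card {f : Fin h → α // IsPosetHom (chainRel h) p f} := by
  rw [← Nat.card_sigma]
  exact Nat.card_congr (Equiv.sigmaFiberEquiv chainTrace)

/-- First claim in the proof of Lemma 7: `t(K_{w,1,w,1,…}, P) ≥ t(C_h, P)^w`. -/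
theorem alt_density_bound {α : Type*} [Fintype α] (p : α → α → Prop)
    (hp : IsStrictOrd p) (h w : ℕ) (hh : 0 < h) (hw : 0 < w) :
    homDensity (chainRel h) p ^ w ≤ homDensity (altRel h w) p := by
  unfold homDensity
  rcases Nat.eq_zero_or_pos (Fintype.card α) with hn | hn
  · rw [hn, Fintype.card_fin, Nat.cast_zero, zero_pow hh.ne', div_zero, zero_pow hw.ne']
    positivity
  have hn' : (0 : ℝ) < Fintype.card α := by exact_mod_cast hn
  have hcard := card_alt_add (h := h) hw
  have hsum := sum_card_chainTrace p h
  have hle := sum_card_chainTrace_pow_le hp (h := h) hw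
  obtain ⟨v, rfl⟩ : ∃ v, w = v + 1 := ⟨w - 1, by omega⟩
  rw [Nat.add_sub_cancel] at hcard
  have hmean := pow_sum_div_card_le_sum_pow (s := (Finset.univ : Finset (SingletonClass h → α)))
    (f := fun x => (Nat.card
      {f : {f : Fin h → α // IsPosetHom (chainRel h) p f} // chainTrace f = x} : ℝ))
    (fun _ _ => Nat.cast_nonneg _) v
  rw [← Nat.cast_sum, hsum, Finset.card_univ, Fintype.card_fun] at hmean
  have hle' := (Nat.cast_le (α := ℝ)).2 hle
  push_cast at hle' hmean
  have hbound := hmean.trans hle'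
  rw [← pow_mul, div_le_iff₀ (by positivity)] at hbound
  rw [div_pow, Fintype.card_fin, ← pow_mul, ← hcard,
    div_le_div_iff₀ (by positivity) (by positivity),
    pow_add (Fintype.card α : ℝ), mul_comm ((Fintype.card α : ℝ) ^ _), ← mul_assoc]
  exact mul_le_mul_of_nonneg_right hbound (by positivity)
end

section
/- Let h and w be positive integers and let L denote the complete h-partite poset K_{w_1,…,w_h} with w_i = w for odd i and w_i = 1 for even i. Then for every finite poset P, t(K_{h×w}, P) ≥ t(L, P)^w. -/
/-- The map on `Fin h × Fin w` equal to `x` on the even layers and, on each odd layer `i`,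
sending `(i, a)` to `y a i`. -/
def mergeLayers {α : Type*} {h w : ℕ} (x : {i : Fin h // i.val % 2 = 0} × Fin w → α)
    (y : Fin w → {i : Fin h // ¬ i.val % 2 = 0} → α) : Fin h × Fin w → α :=
  fun z => if hz : z.1.val % 2 = 0 then x (⟨z.1, hz⟩, z.2) else y z.2 ⟨z.1, hz⟩

/-- The choices of one element for each odd layer that extend the choice `x` of `w` elements for
each even layer to a homomorphism. -/
abbrev OddExtension {α : Type*} {h w : ℕ} (p : α → α → Prop)
    (x : {i : Fin h // i.val % 2 = 0} × Fin w → α) : Type _ :=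
  {y : {i : Fin h // ¬ i.val % 2 = 0} → α // IsPosetHom (KhwRel h w) p (mergeLayers x fun _ => y)}

theorem mergeLayers_injective {α : Type*} {h w : ℕ}
    {x x' : {i : Fin h // i.val % 2 = 0} × Fin w → α}
    {y y' : Fin w → {i : Fin h // ¬ i.val % 2 = 0} → α}
    (e : mergeLayers x y = mergeLayers x' y') : x = x' ∧ y = y' := by
  constructor
  · ext ⟨⟨i, hi⟩, a⟩
    simpa [mergeLayers, hi] using congrFun e (i, a)
  · ext a ⟨i, hi⟩
    simpa [mergeLayers, hi] using congrFun e (i, a)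

/-- Extensions of the same even layers can be combined: two odd layers are always separated by an
even one. -/
theorem isPosetHom_mergeLayers {α : Type*} {p : α → α → Prop} (hp : IsStrictOrd p) {h w : ℕ}
    (x : {i : Fin h // i.val % 2 = 0} × Fin w → α) (y : Fin w → OddExtension p x) :
    IsPosetHom (KhwRel h w) p (mergeLayers x fun a => (y a).1) := by
  rintro ⟨i, a⟩ ⟨j, b⟩ (hij : i < j)
  by_cases hi : i.val % 2 = 0
  · simpa [mergeLayers, hi] using (y b).2 (x := (i, a)) (y := (j, b)) hij
  by_cases hj : j.val % 2 = 0
  · simpa [mergeLayers, hj] using (y a).2 (x := (i, a)) (y := (j, b)) hij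
  have hlt : i.val < j.val := hij
  have hk : i.val + 1 < h := by omega
  let k : Fin h := ⟨i.val + 1, hk⟩
  have hik : i < k := Fin.lt_def.2 (by simp [k])
  have hkj : k < j := Fin.lt_def.2 (by simp only [k]; omega)
  have hk2 : k.val % 2 = 0 := by simp only [k]; omega
  have h₁ := (y a).2 (x := (i, a)) (y := (k, a)) hik
  have h₂ := (y b).2 (x := (k, a)) (y := (j, b)) hkj
  simp only [mergeLayers, hi, hj, hk2, dite_true, dite_false] at h₁ h₂ ⊢
  exact hp.2 h₁ h₂

theorem card_altRel_hom_le {α : Type*} [Fintype α] (p : α → α → Prop) {h w : ℕ} (hw : 0 < w) :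
    Nat.card {f : (Σ i : Fin h, Fin (altSizes w i)) → α // IsPosetHom (altRel h w) p f} ≤
      ∑ x : {i : Fin h // i.val % 2 = 0} × Fin w → α, Nat.card (OddExtension p x) := by
  classical
  rw [← Nat.card_sigma]
  have hev (i : Fin h) (hi : i.val % 2 = 0) : w = altSizes w i := by simp [altSizes, hi]
  have hpos (i : Fin h) : 0 < altSizes w i := by unfold altSizes; split <;> omega
  let X (f : (Σ i : Fin h, Fin (altSizes w i)) → α) : {i : Fin h // i.val % 2 = 0} × Fin w → α :=
    fun z => f ⟨z.1.1, Fin.cast (hev _ z.1.2) z.2⟩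
  let Y (f : (Σ i : Fin h, Fin (altSizes w i)) → α) : {i : Fin h // ¬ i.val % 2 = 0} → α :=
    fun z => f ⟨z.1, ⟨0, hpos _⟩⟩
  have hmerge f (z : Fin h × Fin w) : ∃ c, mergeLayers (X f) (fun _ => Y f) z = f ⟨z.1, c⟩ := by
    by_cases hz : z.1.val % 2 = 0
    · exact ⟨_, by simp only [mergeLayers, hz, dite_true, X]; rfl⟩
    · exact ⟨_, by simp only [mergeLayers, hz, dite_false, Y]; rfl⟩
  let F (f : {f : (Σ i : Fin h, Fin (altSizes w i)) → α // IsPosetHom (altRel h w) p f}) :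
      Σ x : {i : Fin h // i.val % 2 = 0} × Fin w → α, OddExtension p x :=
    ⟨X f.1, Y f.1, by
      intro u v huv
      obtain ⟨c, hc⟩ := hmerge f.1 u
      obtain ⟨d, hd⟩ := hmerge f.1 v
      rw [hc, hd]
      exact f.2 huv⟩
  refine Nat.card_le_card_of_injective F ?_
  intro f g hfg
  have hX : X f.1 = X g.1 := congrArg Sigma.fst hfg
  have hY : Y f.1 = Y g.1 := congrArg (fun s => s.2.1) hfg
  ext ⟨i, a⟩
  by_cases hi : i.val % 2 = 0
  · exact congrFun hX (⟨i, hi⟩, Fin.cast (hev i hi).symm a)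
  · have ha : a = ⟨0, hpos i⟩ := by
      have := a.2
      ext
      simp only [altSizes, hi, if_false] at this ⊢
      omega
    rw [ha]
    exact congrFun hY ⟨i, hi⟩

theorem sum_card_pow_le_card_KhwRel_hom {α : Type*} [Fintype α] {p : α → α → Prop}
    (hp : IsStrictOrd p) {h w : ℕ} :
    ∑ x : {i : Fin h // i.val % 2 = 0} × Fin w → α, Nat.card (OddExtension p x) ^ w ≤
      Nat.card {f : Fin h × Fin w → α // IsPosetHom (KhwRel h w) p f} := by
  classical
  have hcard : ∑ x : {i : Fin h // i.val % 2 = 0} × Fin w → α, Nat.card (OddExtension p x) ^ w =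
      Nat.card (Σ x : {i : Fin h // i.val % 2 = 0} × Fin w → α, Fin w → OddExtension p x) := by
    simp
  rw [hcard]
  refine Nat.card_le_card_of_injective
    (fun s => ⟨mergeLayers s.1 fun a => (s.2 a).1, isPosetHom_mergeLayers hp s.1 s.2⟩) ?_
  rintro ⟨x, y⟩ ⟨x', y'⟩ e
  have e' : mergeLayers x (fun a => (y a).1) = mergeLayers x' (fun a => (y' a).1) :=
    congrArg Subtype.val e
  obtain ⟨rfl, hy⟩ := mergeLayers_injective e'
  congr 1
  exact funext fun a => Subtype.ext (congrFun hy a)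

theorem card_altSizes_sigma (h w : ℕ) :
    Fintype.card (Σ i : Fin h, Fin (altSizes w i)) =
      Fintype.card {i : Fin h // i.val % 2 = 0} * w +
        Fintype.card {i : Fin h // ¬ i.val % 2 = 0} := by
  simp only [Fintype.card_sigma, Fintype.card_fin]
  simp only [altSizes, Finset.sum_ite, Finset.sum_const, smul_eq_mul, mul_one,
    Fintype.card_subtype]

/-- Second claim in the proof of Lemma 7: `t(K_{h×w}, P) ≥ t(K_{w,1,w,1,…}, P)^w`. -/
theorem khw_vs_alt_density_bound {α : Type*} [Fintype α] (p : α → α → Prop)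
    (hp : IsStrictOrd p) (h w : ℕ) (hh : 0 < h) (hw : 0 < w) :
    homDensity (altRel h w) p ^ w ≤ homDensity (KhwRel h w) p := by
  classical
  unfold homDensity
  rw [card_altSizes_sigma]
  have hsplit : h = Fintype.card {i : Fin h // i.val % 2 = 0} +
      Fintype.card {i : Fin h // ¬ i.val % 2 = 0} := by
    have := Fintype.card_subtype_compl (fun i : Fin h => i.val % 2 = 0)
    have := Fintype.card_subtype_le (fun i : Fin h => i.val % 2 = 0)
    simp only [Fintype.card_fin] at *
    omega
  have hK : Fintype.card (Fin h × Fin w) = (Fintype.card {i : Fin h // i.val % 2 = 0} +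
      Fintype.card {i : Fin h // ¬ i.val % 2 = 0}) * w := by
    rw [← hsplit]; simp
  rw [hK]
  have hL := card_altRel_hom_le (h := h) p hw
  have hKh := sum_card_pow_le_card_KhwRel_hom (h := h) (w := w) hp
  have hX : Fintype.card ({i : Fin h // i.val % 2 = 0} × Fin w → α) =
      Fintype.card α ^ (Fintype.card {i : Fin h // i.val % 2 = 0} * w) := by simp
  have hjensen := pow_sum_div_card_le_sum_pow (s := Finset.univ)
    (f := fun x : {i : Fin h // i.val % 2 = 0} × Fin w → α => (Nat.card (OddExtension p x) : ℝ))
    (fun _ _ => Nat.cast_nonneg _) (w - 1)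
  rw [Nat.sub_add_cancel hw, Finset.card_univ, hX] at hjensen
  generalize Fintype.card {i : Fin h // i.val % 2 = 0} = a at *
  generalize Fintype.card {i : Fin h // ¬ i.val % 2 = 0} = b at *
  obtain ⟨v, rfl⟩ : ∃ v, w = v + 1 := ⟨w - 1, by omega⟩
  simp only [Nat.add_sub_cancel] at hjensen
  push_cast at hjensen
  generalize Fintype.card α = n at *
  rcases Nat.eq_zero_or_pos n with rfl | hn
  · have hab : a * (v + 1) + b ≠ 0 := by
      rcases Nat.eq_zero_or_pos a with rfl | ha
      · omega
      · positivity
    simp only [Nat.cast_zero, zero_pow hab, div_zero, zero_pow hw.ne']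
    positivity
  have hn' : (0 : ℝ) < n := Nat.cast_pos.2 hn
  have hL' := (Nat.cast_le (α := ℝ)).2 hL
  have hK' := (Nat.cast_le (α := ℝ)).2 hKh
  push_cast at hL' hK'
  rw [div_le_iff₀ (by positivity)] at hjensen
  rw [div_pow, div_le_div_iff₀ (by positivity) (by positivity)]
  have hexp : ((n : ℝ) ^ (a * (v + 1) + b)) ^ (v + 1) =
      ((n : ℝ) ^ (a * (v + 1))) ^ v * (n : ℝ) ^ ((a + b) * (v + 1)) := by
    rw [← pow_mul, ← pow_mul, ← pow_add]
    ring_nf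
  rw [hexp, ← mul_assoc]
  gcongr
  calc _ ≤ _ := pow_le_pow_left₀ (Nat.cast_nonneg _) hL' _
    _ ≤ _ := hjensen
    _ ≤ _ := by gcongr
end

section
/- Let ε > 0 and let h ≥ 2, w ≥ 1 be integers such that εw is an integer, and let P be the complete h-partite poset K_{εw, w, w, …, w} (first class of size εw, the other h−1 classes of size w). Then for every c with 0 < c < εw and every integer k ≤ c/(2ε), the probability that a uniformly random k-element subset of P contains no h elements forming a chain (i.e., contains no copy of C_h) is at least e^{−c}. -/
/-- The complete `h`-partite poset `K_{a,w,w,…,w}`: first class of size `a`, the other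
`h-1` classes of size `w`; `x ≺ y` iff the class of `x` is below the class of `y`. -/
def unbalancedRel (h a w : ℕ) : (Σ i : Fin h, Fin (if i.val = 0 then a else w)) →
    (Σ i : Fin h, Fin (if i.val = 0 then a else w)) → Prop :=
  fun x y => x.1 < y.1

/-- If `a = ε w`, `w ≤ M` and `2 k ≤ w`, enlarging the ground set from `M` to `M + a` points
multiplies the number of `k`-subsets by at most `exp (2 ε k)`. -/
theorem choose_add_le_choose_mul_exp {M a w : ℕ} {ε : ℝ} (hε : 0 < ε)
    (ha : (a : ℝ) = ε * (w : ℝ)) (hM : w ≤ M) :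
    ∀ k : ℕ, 2 * k ≤ w →
      ((M + a).choose k : ℝ) ≤ (M.choose k : ℝ) * Real.exp (2 * ε * k) := by
  intro k
  induction k with
  | zero => simp
  | succ k ih =>
    intro hk
    have ih := ih (by omega)
    have e₁ : ((M + a).choose (k + 1) : ℝ) * (k + 1) = (M + a).choose k * (M + a - k) := by
      have h := Nat.choose_succ_right_eq (M + a) k
      have h' : (((M + a).choose (k + 1) * (k + 1) : ℕ) : ℝ) =
        (((M + a).choose k * (M + a - k) : ℕ) : ℝ) := by rw [h]
      rw [Nat.cast_mul, Nat.cast_mul, Nat.cast_sub (by omega)] at h'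
      exact_mod_cast h'
    have e₂ : (M.choose (k + 1) : ℝ) * (k + 1) = M.choose k * (M - k) := by
      have h := Nat.choose_succ_right_eq M k
      have h' : ((M.choose (k + 1) * (k + 1) : ℕ) : ℝ) =
        ((M.choose k * (M - k) : ℕ) : ℝ) := by rw [h]
      rw [Nat.cast_mul, Nat.cast_mul, Nat.cast_sub (by omega)] at h'
      exact_mod_cast h'
    have hMw : (w : ℝ) ≤ M := by exact_mod_cast hM
    have hkw : 2 * ((k : ℝ) + 1) ≤ w := by exact_mod_cast hk
    have hpos : (0 : ℝ) ≤ M - k := by linarith [(Nat.cast_nonneg k : (0 : ℝ) ≤ k)]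
    have hstep : (M : ℝ) + a - k ≤ (M - k) * Real.exp (2 * ε) := by
      have h₁ : (M : ℝ) + a - k ≤ (M - k) * (2 * ε + 1) := by
        rw [ha]
        nlinarith
      exact h₁.trans (mul_le_mul_of_nonneg_left (Real.add_one_le_exp _) hpos)
    have hk1 : (0 : ℝ) < k + 1 := by positivity
    refine le_of_mul_le_mul_right ?_ hk1
    have hstep0 : (0 : ℝ) ≤ M + a - k := by linarith [(Nat.cast_nonneg a : (0 : ℝ) ≤ a)]
    calc ((M + a).choose (k + 1) : ℝ) * (k + 1)
        = (M + a).choose k * (M + a - k) := e₁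
      _ ≤ (M.choose k * Real.exp (2 * ε * k)) * ((M - k) * Real.exp (2 * ε)) :=
          mul_le_mul ih hstep hstep0 (by positivity)
      _ = (M.choose k * (M - k)) * (Real.exp (2 * ε * k) * Real.exp (2 * ε)) := by ring
      _ = (M.choose (k + 1) * (k + 1)) * Real.exp (2 * ε * (k + 1 : ℕ)) := by
          rw [← e₂, ← Real.exp_add]
          congr 2
          push_cast
          ring
      _ = _ := by ring

/-- A chain of `h` elements in a poset graded over `Fin h` meets the lowest class. -/
theorem exists_val_eq_zero_of_strictMono {h : ℕ} (hh : 0 < h) {g : Fin h → Fin h}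
    (hg : StrictMono g) : ∃ i, (g i).val = 0 := by
  obtain ⟨i, hi⟩ := Finite.surjective_of_injective hg.injective ⟨0, hh⟩
  exact ⟨i, by rw [hi]⟩

/-- **Proposition 8 (b)**. Let `P = K_{εw,w,…,w}` with `h` classes. For `0 < c < εw` and
`k ≤ c/(2ε)`, a uniformly random `k`-element subset of `P` contains no copy of `C_h`
with probability at least `e^{-c}`. -/
theorem unbalanced_sample {h a w k : ℕ} (hh : 2 ≤ h) (hw : 1 ≤ w)
    (ε c : ℝ) (hε : 0 < ε) (ha : (a : ℝ) = ε * (w : ℝ))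
    (hc0 : 0 < c) (hc1 : c < ε * (w : ℝ)) (hk : (k : ℝ) ≤ c / (2 * ε)) :
    Real.exp (-c) ≤
      (Nat.card {s : Finset (Σ i : Fin h, Fin (if i.val = 0 then a else w)) //
          s.card = k ∧
          ¬ ∃ f : Fin h → (Σ i : Fin h, Fin (if i.val = 0 then a else w)),
            (∀ i, f i ∈ s) ∧
            ∀ i j : Fin h, i < j → unbalancedRel h a w (f i) (f j)} : ℝ) /
        ((Fintype.card (Σ i : Fin h, Fin (if i.val = 0 then a else w))).choose k : ℝ) := by
  classical
  obtain ⟨n, rfl⟩ : ∃ n, h = n + 2 := ⟨h - 2, by omega⟩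
  let V := Σ i : Fin (n + 2), Fin (if i.val = 0 then a else w)
  let T : Finset V := (Finset.univ.erase 0).sigma fun _ => Finset.univ
  have hTcard : T.card = ∑ i ∈ (Finset.univ : Finset (Fin (n + 2))).erase 0,
      if i.val = 0 then a else w := by
    refine (Finset.card_sigma _ _).trans (Finset.sum_congr rfl fun i _ => ?_)
    rw [Finset.card_univ, Fintype.card_fin]
  have hV : Fintype.card V = T.card + a := by
    have h₁ := Finset.sum_erase_add (Finset.univ : Finset (Fin (n + 2)))
      (fun i => if i.val = 0 then a else w) (Finset.mem_univ 0)
    rw [hTcard, Fintype.card_sigma]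
    simpa using h₁.symm
  have hT : w ≤ T.card := by
    have h₁ := Finset.single_le_sum (s := (Finset.univ : Finset (Fin (n + 2))).erase 0)
      (f := fun i => if i.val = 0 then a else w) (fun _ _ => Nat.zero_le _)
      (Finset.mem_erase.2 ⟨one_ne_zero, Finset.mem_univ 1⟩)
    simp only [Fin.val_one, one_ne_zero, if_false] at h₁
    rwa [hTcard]
  have hkc : 2 * ε * k ≤ c := by
    rw [le_div_iff₀ (by positivity)] at hk
    linarith
  have hkw : 2 * k ≤ w := by
    have h₁ : ε * (2 * k) ≤ ε * w := by linarith
    exact_mod_cast le_of_mul_le_mul_left h₁ hε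
  have hcard : T.card.choose k ≤ Nat.card {s : Finset V // s.card = k ∧
      ¬ ∃ f : Fin (n + 2) → V, (∀ i, f i ∈ s) ∧
        ∀ i j : Fin (n + 2), i < j → unbalancedRel (n + 2) a w (f i) (f j)} := by
    rw [← Finset.card_powersetCard, Nat.card_eq_fintype_card, Fintype.card_subtype]
    refine Finset.card_le_card fun s hs => ?_
    rw [Finset.mem_powersetCard] at hs
    refine Finset.mem_filter.2 ⟨Finset.mem_univ _, hs.2, ?_⟩
    rintro ⟨f, hfs, hf⟩
    obtain ⟨i, hi⟩ := exists_val_eq_zero_of_strictMono (by omega)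
      (g := fun i => (f i).1) (fun i j hij => hf i j hij)
    have hmem := (Finset.mem_sigma.1 (hs.1 (hfs i))).1
    exact Finset.ne_of_mem_erase hmem (Fin.ext hi)
  have hpos : (0 : ℝ) < (Fintype.card V).choose k := by
    exact_mod_cast Nat.choose_pos (by omega)
  rw [le_div_iff₀ hpos]
  calc Real.exp (-c) * ((Fintype.card V).choose k : ℝ)
      ≤ Real.exp (-c) * (T.card.choose k * Real.exp (2 * ε * k)) := by
        rw [hV]
        exact mul_le_mul_of_nonneg_left (choose_add_le_choose_mul_exp hε ha hT k hkw)
          (Real.exp_pos _).le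
    _ ≤ Real.exp (-c) * (T.card.choose k * Real.exp c) := by gcongr
    _ = T.card.choose k := by
        rw [mul_left_comm, ← Real.exp_add, neg_add_cancel, Real.exp_zero, mul_one]
    _ ≤ _ := by exact_mod_cast hcard
end
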